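/- arXiv:0905.3705 — 2 statements merged into one kernel-verified Lean document; each statement's English description precedes it below -/
import Mathlib

section
/- Let F and G be smooth cubics in ℂ[X,Y,Z] that meet transversally at every point of their common projective zero set, and suppose F is not a scalar multiple of G. Then the common projective zero set of F and G in ℙ² consists of exactly nine points. -/
open MvPolynomial

/-- The gradient of a polynomial in `ℂ[X,Y,Z]` at a point of `ℂ³`. -/
noncomputable def grad (F : MvPolynomial (Fin 3) ℂ) (v : Fin 3 → ℂ) : Fin 3 → ℂ :=
  fun i => eval v (pderiv i F)

/-- A cubic: a nonzero homogeneous polynomial of degree 3 in `ℂ[X,Y,Z]`. -/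
def IsCubic (F : MvPolynomial (Fin 3) ℂ) : Prop :=
  F ≠ 0 ∧ F.IsHomogeneous 3

/-- A smooth cubic: `(0,0,0)` is the only common zero in `ℂ³` of the three
partial derivatives. -/
def SmoothCubic (F : MvPolynomial (Fin 3) ℂ) : Prop :=
  IsCubic F ∧ ∀ v : Fin 3 → ℂ, grad F v = 0 → v = 0

/-- `F` and `G` meet transversally at (the projective point represented by) `v`:
their gradients at `v` are linearly independent over `ℂ`. -/
def Transverse (F G : MvPolynomial (Fin 3) ℂ) (v : Fin 3 → ℂ) : Prop :=
  LinearIndependent ℂ ![grad F v, grad G v]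

/-- Two nonzero vectors of `ℂ³` represent the same point of `ℙ²`. -/
def SameProjPt (u v : Fin 3 → ℂ) : Prop :=
  ∃ c : ℂ, c ≠ 0 ∧ c • u = v

/-- The common projective zero set of `F` and `G` consists of exactly the nine
distinct points of `ℙ²` represented by `p 0, …, p 8`. -/
def NinePoints (F G : MvPolynomial (Fin 3) ℂ) (p : Fin 9 → Fin 3 → ℂ) : Prop :=
  (∀ i, p i ≠ 0) ∧
  (∀ i j, i ≠ j → ¬ SameProjPt (p i) (p j)) ∧
  (∀ i, eval (p i) F = 0 ∧ eval (p i) G = 0) ∧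
  (∀ v : Fin 3 → ℂ, v ≠ 0 → eval v F = 0 → eval v G = 0 → ∃ i, SameProjPt (p i) v)

open scoped Matrix

/-! ### Vectors in `ℂ³` -/

lemma sameProjPt_of_cross_eq_zero {u v : Fin 3 → ℂ} (hu : u ≠ 0) (hv : v ≠ 0)
    (h : u ⨯₃ v = 0) : SameProjPt u v := by
  have h1 : ¬ LinearIndependent ℂ ![u, v] := fun hl =>
    crossProduct_ne_zero_iff_linearIndependent.2 hl h
  rw [LinearIndependent.pair_iff' hu] at h1
  push Not at h1
  obtain ⟨c, hc⟩ := h1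
  refine ⟨c, ?_, hc⟩
  rintro rfl
  exact hv (by simpa using hc.symm)

lemma SameProjPt.cross_eq_zero {u v : Fin 3 → ℂ} (h : SameProjPt u v) : u ⨯₃ v = 0 := by
  obtain ⟨c, -, rfl⟩ := h
  simp

lemma dot_cross_cyclic (u v w : Fin 3 → ℂ) : (u ⨯₃ v) ⬝ᵥ w = (v ⨯₃ w) ⬝ᵥ u := by
  rw [dotProduct_comm, triple_product_permutation, dotProduct_comm]

lemma exists_cross_ne_zero {u : Fin 3 → ℂ} (hu : u ≠ 0) : ∃ w, u ⨯₃ w ≠ 0 := by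
  by_contra! h
  apply hu
  have h0 := h ![1, 0, 0]
  have h1 := h ![0, 1, 0]
  rw [cross_apply] at h0 h1
  have e1 := congrFun h0 1
  have e2 := congrFun h0 2
  have e3 := congrFun h1 2
  ext i
  fin_cases i <;> simp_all

/-- A point off the zero set of a given polynomial and off finitely many planes through `0`. -/
lemma exists_eval_ne_zero_and_dotProduct_ne_zero {H : MvPolynomial (Fin 3) ℂ} (hH : H ≠ 0)
    (T : Finset (Fin 3 → ℂ)) :
    ∃ v : Fin 3 → ℂ, eval v H ≠ 0 ∧ ∀ t ∈ T, t ≠ 0 → t ⬝ᵥ v ≠ 0 := by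
  classical
  let L : (Fin 3 → ℂ) → MvPolynomial (Fin 3) ℂ := fun t => ∑ i, C (t i) * X i
  have hL : ∀ t v, eval v (L t) = t ⬝ᵥ v := fun t v => by simp [L, dotProduct]
  have hL0 : ∀ t, t ≠ 0 → L t ≠ 0 := by
    intro t ht h
    apply ht
    ext i
    have := hL t (Pi.single i 1)
    simpa [h] using this.symm
  have hprod : H * ∏ t ∈ T.filter (· ≠ 0), L t ≠ 0 :=
    mul_ne_zero hH (Finset.prod_ne_zero_iff.2 fun t ht => hL0 t (Finset.mem_filter.1 ht).2)
  obtain ⟨v, hv⟩ : ∃ v, eval v (H * ∏ t ∈ T.filter (· ≠ 0), L t) ≠ 0 := by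
    by_contra! h
    exact hprod (MvPolynomial.funext fun v => by simpa using h v)
  rw [map_mul, map_prod] at hv
  refine ⟨v, left_ne_zero_of_mul hv, fun t ht ht0 => ?_⟩
  rw [← hL]
  exact Finset.prod_ne_zero_iff.1 (right_ne_zero_of_mul hv) t (Finset.mem_filter.2 ⟨ht, ht0⟩)

/-- Three vectors with nonzero triple product span `ℂ³`. -/
lemma exists_eq_add_of_triple_ne_zero {Q N P : Fin 3 → ℂ} (h : (P ⨯₃ Q) ⬝ᵥ N ≠ 0)
    (v : Fin 3 → ℂ) : ∃ a b c : ℂ, v = a • Q + b • N + c • P := by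
  refine ⟨((N ⨯₃ P) ⬝ᵥ v) / ((P ⨯₃ Q) ⬝ᵥ N), ((P ⨯₃ Q) ⬝ᵥ v) / ((P ⨯₃ Q) ⬝ᵥ N),
    ((Q ⨯₃ N) ⬝ᵥ v) / ((P ⨯₃ Q) ⬝ᵥ N), ?_⟩
  have : ((P ⨯₃ Q) ⬝ᵥ N) • v = ((N ⨯₃ P) ⬝ᵥ v) • Q + ((P ⨯₃ Q) ⬝ᵥ v) • N +
      ((Q ⨯₃ N) ⬝ᵥ v) • P := by
    ext i
    fin_cases i <;> simp [cross_apply, dotProduct, Fin.sum_univ_three] <;> ring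
  rw [← sub_eq_zero] at this ⊢
  rw [← smul_right_injective _ h |>.eq_iff, smul_zero, ← this]
  simp only [smul_sub, smul_add, smul_smul, mul_div_cancel₀ _ h]

/-! ### Restriction of a ternary form to a line -/

section Line

variable {A B : Type*} [CommRing A] [Algebra ℂ A] [CommRing B] [Algebra ℂ B]

/-- The restriction of `F` to the line `Z ↦ w + Z P`. -/
noncomputable def linePoly (w P : Fin 3 → A) (F : MvPolynomial (Fin 3) ℂ) : Polynomial A :=
  aeval (fun i => Polynomial.C (w i) + Polynomial.C (P i) * Polynomial.X) F

lemma linePoly_map (φ : A →ₐ[ℂ] B) (w P : Fin 3 → A) (F : MvPolynomial (Fin 3) ℂ) :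
    (linePoly w P F).map (φ : A →+* B) = linePoly (φ ∘ w) (φ ∘ P) F := by
  have : (Polynomial.mapAlgHom φ).comp
      (aeval fun i => Polynomial.C (w i) + Polynomial.C (P i) * Polynomial.X) =
      aeval (R := ℂ) fun i => Polynomial.C (φ (w i)) + Polynomial.C (φ (P i)) * Polynomial.X := by
    ext i : 1
    simp
  exact DFunLike.congr_fun this F

lemma eval_linePoly (w P : Fin 3 → A) (F : MvPolynomial (Fin 3) ℂ) (z : A) :
    (linePoly w P F).eval z = aeval (w + z • P) F := by
  have : ((Polynomial.aeval z).restrictScalars ℂ).comp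
      (aeval fun i => Polynomial.C (w i) + Polynomial.C (P i) * Polynomial.X) =
      aeval (R := ℂ) (w + z • P) := by
    ext i : 1
    simp [mul_comm (P i)]
  exact DFunLike.congr_fun this F

lemma linePoly_natDegree_le_and_coeff {F : MvPolynomial (Fin 3) ℂ} {n : ℕ}
    (hF : F.IsHomogeneous n) (w P : Fin 3 → A) :
    (linePoly w P F).natDegree ≤ n ∧ (linePoly w P F).coeff n = aeval P F := by
  have hl : ∀ i, (Polynomial.C (w i) + Polynomial.C (P i) * Polynomial.X).natDegree ≤ 1 := by
    intro i
    compute_degree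
  have hlc : ∀ i, (Polynomial.C (w i) + Polynomial.C (P i) * Polynomial.X).coeff 1 = P i := by
    intro i
    simp [Polynomial.coeff_C]
  have hd : ∀ i k, ((Polynomial.C (w i) + Polynomial.C (P i) * Polynomial.X) ^ k).natDegree ≤ k :=
    fun i k => by simpa using Polynomial.natDegree_pow_le_of_le k (hl i)
  have hc : ∀ i k, ((Polynomial.C (w i) + Polynomial.C (P i) * Polynomial.X) ^ k).coeff k =
      P i ^ k := fun i k => by
    have := Polynomial.coeff_pow_of_natDegree_le (m := k) (hl i)
    rwa [hlc, mul_one] at this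
  have hm : ∀ d ∈ F.support, d 0 + d 1 + d 2 = n := by
    intro d hd
    have := hF (mem_support_iff.1 hd)
    rw [← this, Finsupp.weight_apply, Finsupp.sum_fintype _ _ (by simp)]
    simp [Fin.sum_univ_three]
  rw [linePoly, aeval_def, aeval_def, eval₂_eq', eval₂_eq']
  simp only [Fin.prod_univ_three]
  have key : ∀ a b c : ℕ,
      ((Polynomial.C (w 0) + Polynomial.C (P 0) * Polynomial.X) ^ a *
      (Polynomial.C (w 1) + Polynomial.C (P 1) * Polynomial.X) ^ b *
      (Polynomial.C (w 2) + Polynomial.C (P 2) * Polynomial.X) ^ c).natDegree ≤ a + b + c ∧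
      ((Polynomial.C (w 0) + Polynomial.C (P 0) * Polynomial.X) ^ a *
      (Polynomial.C (w 1) + Polynomial.C (P 1) * Polynomial.X) ^ b *
      (Polynomial.C (w 2) + Polynomial.C (P 2) * Polynomial.X) ^ c).coeff (a + b + c) =
      P 0 ^ a * P 1 ^ b * P 2 ^ c := by
    intro a b c
    have h1 := Polynomial.natDegree_mul_le_of_le (hd 0 a) (hd 1 b)
    refine ⟨Polynomial.natDegree_mul_le_of_le h1 (hd 2 c), ?_⟩
    rw [Polynomial.coeff_mul_add_eq_of_natDegree_le h1 (hd 2 c),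
      Polynomial.coeff_mul_add_eq_of_natDegree_le (hd 0 a) (hd 1 b), hc, hc, hc]
  constructor
  · refine Polynomial.natDegree_sum_le_of_forall_le _ _ fun d hd => ?_
    rw [Polynomial.algebraMap_apply]
    refine (Polynomial.natDegree_C_mul_le _ _).trans ?_
    exact (hm d hd) ▸ (key _ _ _).1
  · rw [Polynomial.finsetSum_coeff]
    refine Finset.sum_congr rfl fun d hd => ?_
    rw [Polynomial.algebraMap_apply, Polynomial.coeff_C_mul, ← hm d hd, (key _ _ _).2]

end Line

/-! ### First-order expansion over the dual numbers -/

open TrivSqZeroExt in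
lemma aeval_inl_add_inr (p u : Fin 3 → ℂ) (F : MvPolynomial (Fin 3) ℂ) :
    aeval (fun i => (inl (p i) + inr (u i) : DualNumber ℂ)) F =
      inl (eval p F) + inr (grad F p ⬝ᵥ u) := by
  induction F using MvPolynomial.induction_on with
  | C a =>
    ext <;> simp [grad, dotProduct, TrivSqZeroExt.algebraMap_eq_inl]
  | add f g hf hg =>
    rw [map_add, hf, hg]
    ext <;> simp [grad, dotProduct, add_mul, Finset.sum_add_distrib]
  | mul_X f j hf =>
    rw [map_mul, hf, aeval_X]
    ext
    · simp
    · simp only [grad, dotProduct, Fin.sum_univ_three]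
      fin_cases j <;> simp [pderiv_X] <;> ring

lemma grad_dotProduct_self {F : MvPolynomial (Fin 3) ℂ} {n : ℕ} (hF : F.IsHomogeneous n)
    (v : Fin 3 → ℂ) : grad F v ⬝ᵥ v = n * eval v F := by
  have := congrArg (eval v) hF.sum_X_mul_pderiv
  simpa [grad, dotProduct, mul_comm] using this

/-- At a transversal common zero, only radial directions kill both gradients. -/
lemma Transverse.cross_eq_zero {F G : MvPolynomial (Fin 3) ℂ} {m n : ℕ} (hF : F.IsHomogeneous m)
    (hG : G.IsHomogeneous n) {v u : Fin 3 → ℂ} (h : Transverse F G v)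
    (hFv : eval v F = 0) (hGv : eval v G = 0)
    (hFu : grad F v ⬝ᵥ u = 0) (hGu : grad G v ⬝ᵥ u = 0) : v ⨯₃ u = 0 :=
  (Configuration.ofField.crossProduct_eq_zero_of_dotProduct_eq_zero
    (by rw [grad_dotProduct_self hF, hFv, mul_zero])
    (by rw [grad_dotProduct_self hG, hGv, mul_zero]) hFu hGu).resolve_left
    (crossProduct_ne_zero_iff_linearIndependent.2 h)

lemma natDegree_linePoly {A : Type*} [CommRing A] [Algebra ℂ A] {F : MvPolynomial (Fin 3) ℂ}
    {n : ℕ} (hF : F.IsHomogeneous n) (w : Fin 3 → A) {P : Fin 3 → A} (hP : aeval P F ≠ 0) :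
    (linePoly w P F).natDegree = n :=
  Polynomial.natDegree_eq_of_le_of_coeff_ne_zero (linePoly_natDegree_le_and_coeff hF w P).1
    (by rwa [(linePoly_natDegree_le_and_coeff hF w P).2])

/-! ### Projection from a point and the resultant -/

/-- The form `F` in the affine coordinates `(x, z) ↦ x Q + N + z P`. -/
noncomputable def affinePoly (Q N P : Fin 3 → ℂ) (F : MvPolynomial (Fin 3) ℂ) :
    Polynomial (Polynomial ℂ) :=
  linePoly (fun i => Polynomial.X * Polynomial.C (Q i) + Polynomial.C (N i))
    (fun i => Polynomial.C (P i)) F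

/-- The polynomial whose roots are the `x` such that two cubics `F` and `G` have a common zero
of the form `x Q + N + z P`. -/
noncomputable def cubicResultant (Q N P : Fin 3 → ℂ) (F G : MvPolynomial (Fin 3) ℂ) :
    Polynomial ℂ :=
  Polynomial.resultant (affinePoly Q N P F) (affinePoly Q N P G) 3 3

variable {F G : MvPolynomial (Fin 3) ℂ} {Q N P : Fin 3 → ℂ}

lemma affinePoly_map_eval (x : ℂ) :
    (affinePoly Q N P F).map (Polynomial.evalRingHom x) = linePoly (x • Q + N) P F := by
  have : Polynomial.evalRingHom x = (Polynomial.aeval (R := ℂ) x : Polynomial ℂ →+* ℂ) := by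
    ext <;> simp
  rw [this, affinePoly, linePoly_map]
  congr 1
  · ext i
    simp [mul_comm x]
  · ext i
    simp

lemma affinePoly_natDegree {n : ℕ} (hF : F.IsHomogeneous n) (hP : eval P F ≠ 0) :
    (affinePoly Q N P F).natDegree = n ∧
      (affinePoly Q N P F).leadingCoeff = Polynomial.C (eval P F) := by
  have h : aeval (fun i => (Polynomial.C (P i) : Polynomial ℂ)) F = Polynomial.C (eval P F) := by
    simpa [Function.comp_def] using
      MvPolynomial.aeval_algebraMap_apply (A := ℂ) (B := Polynomial ℂ) P F
  have hd : (affinePoly Q N P F).natDegree = n := natDegree_linePoly hF _ (by rw [h]; simpa)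
  refine ⟨hd, ?_⟩
  rw [Polynomial.leadingCoeff, hd, affinePoly, (linePoly_natDegree_le_and_coeff hF _ _).2, h]

lemma eval_cubicResultant (x : ℂ) :
    (cubicResultant Q N P F G).eval x =
      Polynomial.resultant (linePoly (x • Q + N) P F) (linePoly (x • Q + N) P G) 3 3 := by
  rw [← affinePoly_map_eval, ← affinePoly_map_eval, Polynomial.resultant_map_map]
  rfl

lemma resultant_eq_zero_iff_exists_root {p q : Polynomial ℂ} (hp : p ≠ 0) :
    Polynomial.resultant p q = 0 ↔ ∃ z, p.eval z = 0 ∧ q.eval z = 0 := by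
  rw [Polynomial.resultant_eq_zero_iff, and_iff_right (Or.inl hp),
    Polynomial.isCoprime_iff_aeval_ne_zero_of_isAlgClosed ℂ ℂ]
  simp [Polynomial.aeval_def]

lemma eval_linePoly_complex (w : Fin 3 → ℂ) (z : ℂ) :
    (linePoly w P F).eval z = eval (w + z • P) F := by
  rw [eval_linePoly, aeval_eq_eval]

lemma grad_dotProduct_eq_eval_derivative (w : Fin 3 → ℂ) (z : ℂ) :
    grad F (w + z • P) ⬝ᵥ P = (linePoly w P F).derivative.eval z := by
  induction F using MvPolynomial.induction_on with
  | C a => simp [grad, dotProduct, linePoly]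
  | add f g hf hg =>
    simp only [linePoly, map_add, Polynomial.eval_add] at *
    rw [← hf, ← hg]
    simp [grad, dotProduct, add_mul, Finset.sum_add_distrib]
  | mul_X f j hf =>
    have he := eval_linePoly_complex (F := f) (P := P) w z
    simp only [linePoly, map_mul, aeval_X, Polynomial.derivative_mul, Polynomial.eval_add,
      Polynomial.eval_mul] at *
    rw [← hf, he]
    simp only [grad, dotProduct, Fin.sum_univ_three]
    fin_cases j <;> simp [pderiv_X] <;> ring

lemma linePoly_ne_zero {n : ℕ} (hF : F.IsHomogeneous n) (hP : eval P F ≠ 0) (w : Fin 3 → ℂ) :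
    linePoly w P F ≠ 0 := by
  intro h
  have := (linePoly_natDegree_le_and_coeff hF w P).2
  rw [h, Polynomial.coeff_zero, aeval_eq_eval] at this
  exact hP this.symm

lemma resultant_linePoly_eq_zero_iff (hF : F.IsHomogeneous 3) (hG : G.IsHomogeneous 3)
    (hFP : eval P F ≠ 0) (hGP : eval P G ≠ 0) (w : Fin 3 → ℂ) :
    Polynomial.resultant (linePoly w P F) (linePoly w P G) 3 3 = 0 ↔
      ∃ z : ℂ, eval (w + z • P) F = 0 ∧ eval (w + z • P) G = 0 := by
  have h := resultant_eq_zero_iff_exists_root (q := linePoly w P G) (linePoly_ne_zero hF hFP w)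
  rw [natDegree_linePoly hF w (by rwa [aeval_eq_eval]),
    natDegree_linePoly hG w (by rwa [aeval_eq_eval])] at h
  simpa only [eval_linePoly_complex] using h

lemma cubicResultant_isRoot_iff (hF : F.IsHomogeneous 3) (hG : G.IsHomogeneous 3)
    (hFP : eval P F ≠ 0) (hGP : eval P G ≠ 0) (x : ℂ) :
    (cubicResultant Q N P F G).eval x = 0 ↔
      ∃ z : ℂ, eval (x • Q + N + z • P) F = 0 ∧ eval (x • Q + N + z • P) G = 0 := by
  rw [eval_cubicResultant, resultant_linePoly_eq_zero_iff hF hG hFP hGP]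

section DualNumber

open TrivSqZeroExt

/-- The substitution `x ↦ x + α ε` into the dual numbers. -/
noncomputable def dualSubst (x α : ℂ) : Polynomial ℂ →ₐ[ℂ] DualNumber ℂ :=
  Polynomial.aeval (inl x + inr α)

/-- The substitution `(x, z) ↦ (x + α ε, z + β ε)` into the dual numbers. -/
noncomputable def dualEval (x z α β : ℂ) : Polynomial (Polynomial ℂ) →+* DualNumber ℂ :=
  Polynomial.eval₂RingHom (dualSubst x α : Polynomial ℂ →+* DualNumber ℂ) (inl z + inr β)

lemma fst_dualSubst (x α : ℂ) (p : Polynomial ℂ) : fst (dualSubst x α p) = p.eval x := by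
  have : (fstHom ℂ ℂ ℂ).comp (dualSubst x α) = Polynomial.aeval x := by
    ext
    simp [dualSubst]
  exact DFunLike.congr_fun this p

/-- The projection of the dual numbers onto `ℂ`. -/
noncomputable def dualFst : DualNumber ℂ →+* ℂ :=
  (fstHom ℂ ℂ ℂ : DualNumber ℂ →ₐ[ℂ] ℂ)

lemma dualFst_apply (a : DualNumber ℂ) : dualFst a = fst a := rfl

lemma dualFst_comp_dualSubst (x α : ℂ) :
    dualFst.comp (dualSubst x α : Polynomial ℂ →+* DualNumber ℂ) = Polynomial.evalRingHom x :=
  RingHom.ext fun p => fst_dualSubst x α p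

lemma fst_dualEval (x z α β : ℂ) (p : Polynomial (Polynomial ℂ)) :
    fst (dualEval x z α β p) = (p.map (Polynomial.evalRingHom x)).eval z := by
  have : dualFst.comp (dualEval x z α β) =
      (Polynomial.evalRingHom z).comp (Polynomial.mapRingHom (Polynomial.evalRingHom x)) := by
    ext <;> simp [dualEval, dualFst_apply, fst_dualSubst]
  exact DFunLike.congr_fun this p

lemma affinePoly_map_dualSubst (x α : ℂ) :
    (affinePoly Q N P F).map (dualSubst x α : Polynomial ℂ →+* DualNumber ℂ) =
      linePoly (fun i => inl ((x • Q + N) i) + inr ((α • Q) i)) (fun i => inl (P i)) F := by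
  rw [affinePoly, linePoly_map]
  congr 1
  · ext i <;> simp [dualSubst, TrivSqZeroExt.algebraMap_eq_inl, mul_comm (Q i)]
  · ext i <;> simp [dualSubst, TrivSqZeroExt.algebraMap_eq_inl]

lemma dualEval_affinePoly (x z α β : ℂ) :
    dualEval x z α β (affinePoly Q N P F) = inl (eval (x • Q + N + z • P) F) +
      inr (grad F (x • Q + N + z • P) ⬝ᵥ (α • Q + β • P)) := by
  rw [← aeval_inl_add_inr, dualEval, Polynomial.coe_eval₂RingHom, Polynomial.eval₂_eq_eval_map,
    affinePoly_map_dualSubst, eval_linePoly]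
  congr 1
  congr 1
  ext i <;> simp

end DualNumber

/-! ### The resultant is nonzero with simple roots -/

lemma affine_point_ne_zero (hD : (P ⨯₃ Q) ⬝ᵥ N ≠ 0) (x z : ℂ) : x • Q + N + z • P ≠ 0 := by
  intro h
  apply hD
  have := congrArg ((P ⨯₃ Q) ⬝ᵥ ·) h
  simpa [dotProduct_comm (P ⨯₃ Q)] using this

lemma eq_zero_of_cross_affine_point_eq_zero (hD : (P ⨯₃ Q) ⬝ᵥ N ≠ 0) {x z s t : ℂ}
    (h : (x • Q + N + z • P) ⨯₃ (s • Q + t • P) = 0) : s = 0 ∧ t = 0 := by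
  have h1 : s * ((P ⨯₃ Q) ⬝ᵥ N) = 0 := by
    have := congrArg (· ⬝ᵥ (-P)) h
    simp only [zero_dotProduct] at this
    rw [← this]
    simp [cross_apply, dotProduct, Fin.sum_univ_three]
    ring
  have h2 : t * ((P ⨯₃ Q) ⬝ᵥ N) = 0 := by
    have := congrArg (· ⬝ᵥ Q) h
    simp only [zero_dotProduct] at this
    rw [← this]
    simp [cross_apply, dotProduct, Fin.sum_univ_three]
    ring
  exact ⟨(mul_eq_zero.1 h1).resolve_right hD, (mul_eq_zero.1 h2).resolve_right hD⟩

/-- Two polynomials over `ℂ[x]` with vanishing resultant, one of which has a nonzero constant as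
leading coefficient, have a nonconstant monic common factor. -/
lemma exists_monic_dvd_of_resultant_eq_zero {f g : Polynomial (Polynomial ℂ)} {a : ℂ}
    (ha : a ≠ 0) (hf : f.leadingCoeff = Polynomial.C a) (h : Polynomial.resultant f g = 0) :
    ∃ d : Polynomial (Polynomial ℂ), d.Monic ∧ d.natDegree ≠ 0 ∧ d ∣ f ∧ d ∣ g := by
  classical
  let K := FractionRing (Polynomial ℂ)
  let φ := algebraMap (Polynomial ℂ) K
  have hφ : Function.Injective φ := IsFractionRing.injective _ _
  have hf0 : f ≠ 0 := by
    rintro rfl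
    exact ha (Polynomial.C_eq_zero.1 (hf.symm.trans Polynomial.leadingCoeff_zero))
  have hK : Polynomial.resultant (f.map φ) (g.map φ) = 0 := by
    rw [Polynomial.natDegree_map_eq_of_injective hφ, Polynomial.natDegree_map_eq_of_injective hφ,
      Polynomial.resultant_map_map, h, map_zero]
  have hcop := (Polynomial.resultant_eq_zero_iff.1 hK).2
  rw [← EuclideanDomain.gcd_isUnit_iff] at hcop
  set e := EuclideanDomain.gcd (f.map φ) (g.map φ)
  have hef : e ∣ f.map φ := EuclideanDomain.gcd_dvd_left _ _
  have heg : e ∣ g.map φ := EuclideanDomain.gcd_dvd_right _ _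
  have he0 : e ≠ 0 := ne_zero_of_dvd_ne_zero ((Polynomial.map_ne_zero_iff hφ).2 hf0) hef
  have hmonic : (Polynomial.C (Polynomial.C a⁻¹) * f).Monic := by
    rw [Polynomial.Monic, Polynomial.leadingCoeff_mul, Polynomial.leadingCoeff_C, hf,
      ← Polynomial.C_mul, inv_mul_cancel₀ ha, Polynomial.C_1]
  obtain ⟨d, hd⟩ := IsIntegrallyClosed.eq_map_mul_C_of_dvd K hmonic (g := e)
    (by rw [Polynomial.map_mul]; exact hef.mul_left _)
  have hdm : (d.map φ).Monic := by
    have := congrArg Polynomial.leadingCoeff hd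
    rw [Polynomial.leadingCoeff_mul, Polynomial.leadingCoeff_C] at this
    exact mul_right_cancel₀ (Polynomial.leadingCoeff_ne_zero.2 he0) (this.trans (one_mul _).symm)
  have hdm' : d.Monic := Polynomial.monic_of_injective hφ hdm
  have hde : d.map φ ∣ e := ⟨_, hd.symm⟩
  refine ⟨d, hdm', fun h0 => hcop ?_, (Polynomial.map_dvd_map φ hφ hdm').1 (hde.trans hef),
    (Polynomial.map_dvd_map φ hφ hdm').1 (hde.trans heg)⟩
  rw [hdm'.natDegree_eq_zero.1 h0, Polynomial.map_one, one_mul] at hd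
  rw [← hd, Polynomial.isUnit_C]
  exact (Polynomial.leadingCoeff_ne_zero.2 he0).isUnit

lemma cubicResultant_ne_zero (hF : F.IsHomogeneous 3) (hG : G.IsHomogeneous 3)
    (hFP : eval P F ≠ 0) (hGP : eval P G ≠ 0) (hD : (P ⨯₃ Q) ⬝ᵥ N ≠ 0)
    (htrans : ∀ v : Fin 3 → ℂ, v ≠ 0 → eval v F = 0 → eval v G = 0 → Transverse F G v) :
    cubicResultant Q N P F G ≠ 0 := by
  intro h0
  obtain ⟨hFd, hFl⟩ := affinePoly_natDegree (Q := Q) (N := N) hF hFP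
  obtain ⟨hGd, -⟩ := affinePoly_natDegree (Q := Q) (N := N) hG hGP
  obtain ⟨d, hdm, hd0, ⟨a, ha⟩, ⟨b, hb⟩⟩ := exists_monic_dvd_of_resultant_eq_zero
    (g := affinePoly Q N P G) hFP hFl (by rw [hFd, hGd]; exact h0)
  obtain ⟨z, hz⟩ := IsAlgClosed.exists_root (d.map (Polynomial.evalRingHom (0 : ℂ))) (by
    rw [hdm.degree_map]
    exact fun h1 => hd0 (Polynomial.natDegree_eq_of_degree_eq_some h1))
  have key : ∀ {H : MvPolynomial (Fin 3) ℂ} {c : Polynomial (Polynomial ℂ)},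
      affinePoly Q N P H = d * c →
      eval ((0 : ℂ) • Q + N + z • P) H = 0 ∧ ∀ α β : ℂ,
        grad H ((0 : ℂ) • Q + N + z • P) ⬝ᵥ (α • Q + β • P) =
          (c.map (Polynomial.evalRingHom (0 : ℂ))).eval z * (dualEval 0 z α β d).snd := by
    intro H c hc
    have h1 : ∀ α β, TrivSqZeroExt.inl (eval ((0 : ℂ) • Q + N + z • P) H) +
        TrivSqZeroExt.inr (grad H ((0 : ℂ) • Q + N + z • P) ⬝ᵥ (α • Q + β • P)) =
        dualEval 0 z α β d * dualEval 0 z α β c := fun α β => by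
      rw [← map_mul, ← hc, dualEval_affinePoly]
    have hfst : ∀ α β, (dualEval 0 z α β d).fst = 0 := fun α β => by
      rw [fst_dualEval]
      exact hz
    refine ⟨?_, fun α β => ?_⟩
    · simpa [hfst] using congrArg TrivSqZeroExt.fst (h1 0 0)
    · simpa [hfst, fst_dualEval, mul_comm] using congrArg TrivSqZeroExt.snd (h1 α β)
  obtain ⟨hFv, hFu⟩ := key ha
  obtain ⟨hGv, hGu⟩ := key hb
  have ht := htrans _ (affine_point_ne_zero hD 0 z) hFv hGv
  by_cases hc : (dualEval 0 z 1 0 d).snd = 0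
  · have := ht.cross_eq_zero hF hG (u := (1 : ℂ) • Q + (0 : ℂ) • P) hFv hGv
      (by rw [hFu, hc, mul_zero]) (by rw [hGu, hc, mul_zero])
    exact one_ne_zero (eq_zero_of_cross_affine_point_eq_zero hD this).1
  · have hlin : ∀ H : MvPolynomial (Fin 3) ℂ, ∀ v : Fin 3 → ℂ, ∀ s t : ℂ,
        grad H v ⬝ᵥ (s • Q + t • P) = s * (grad H v ⬝ᵥ ((1 : ℂ) • Q + (0 : ℂ) • P)) +
          t * (grad H v ⬝ᵥ ((0 : ℂ) • Q + (1 : ℂ) • P)) := by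
      intro H v s t
      simp
    have := ht.cross_eq_zero hF hG
      (u := (dualEval 0 z 0 1 d).snd • Q + (-(dualEval 0 z 1 0 d).snd) • P) hFv hGv
      (by rw [hlin, hFu, hFu]; ring) (by rw [hlin, hGu, hGu]; ring)
    exact hc (neg_eq_zero.1 (eq_zero_of_cross_affine_point_eq_zero hD this).2)

/-- A transversal common zero which is the only one on its line through `P` and at which that
line is not tangent to `F` gives a simple root of the resultant. -/
lemma not_sq_dvd_cubicResultant (hF : F.IsHomogeneous 3) (hG : G.IsHomogeneous 3)
    (hFP : eval P F ≠ 0) (hGP : eval P G ≠ 0) (hD : (P ⨯₃ Q) ⬝ᵥ N ≠ 0) {x z : ℂ}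
    (hFv : eval (x • Q + N + z • P) F = 0) (hGv : eval (x • Q + N + z • P) G = 0)
    (ht : Transverse F G (x • Q + N + z • P)) (htan : grad F (x • Q + N + z • P) ⬝ᵥ P ≠ 0)
    (huniq : ∀ z', eval (x • Q + N + z' • P) F = 0 → eval (x • Q + N + z' • P) G = 0 → z' = z) :
    ¬ (Polynomial.X - Polynomial.C x) ^ 2 ∣ cubicResultant Q N P F G := by
  intro hdvd
  set v := x • Q + N + z • P with hv
  set β : ℂ := -(grad F v ⬝ᵥ Q) / (grad F v ⬝ᵥ P) with hβ
  set f := (affinePoly Q N P F).map (dualSubst x 1 : Polynomial ℂ →+* DualNumber ℂ) with hf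
  set g := (affinePoly Q N P G).map (dualSubst x 1 : Polynomial ℂ →+* DualNumber ℂ) with hg
  set r : DualNumber ℂ := TrivSqZeroExt.inl z + TrivSqZeroExt.inr β with hr
  have hres : Polynomial.resultant f g 3 3 = 0 := by
    obtain ⟨c, hc⟩ := hdvd
    have h1 : dualSubst x 1 (Polynomial.X - Polynomial.C x) = TrivSqZeroExt.inr 1 := by
      ext <;> simp [dualSubst, TrivSqZeroExt.algebraMap_eq_inl]
    rw [hf, hg, Polynomial.resultant_map_map, ← cubicResultant, RingHom.coe_coe, hc, map_mul,
      map_pow, h1, pow_two, TrivSqZeroExt.inr_mul_inr, zero_mul]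
  have heval : ∀ H : MvPolynomial (Fin 3) ℂ, ((affinePoly Q N P H).map
      (dualSubst x 1 : Polynomial ℂ →+* DualNumber ℂ)).eval r =
      TrivSqZeroExt.inl (eval v H) + TrivSqZeroExt.inr (grad H v ⬝ᵥ ((1 : ℂ) • Q + β • P)) := by
    intro H
    rw [← dualEval_affinePoly, dualEval, Polynomial.coe_eval₂RingHom, Polynomial.eval₂_eq_eval_map]
  have hFu : grad F v ⬝ᵥ ((1 : ℂ) • Q + β • P) = 0 := by
    simp only [dotProduct_add, dotProduct_smul, smul_eq_mul, hβ]
    field_simp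
    ring
  have hGu : grad G v ⬝ᵥ ((1 : ℂ) • Q + β • P) ≠ 0 := fun h =>
    one_ne_zero (eq_zero_of_cross_affine_point_eq_zero hD
      (ht.cross_eq_zero hF hG hFv hGv hFu h)).1
  obtain ⟨q, hq⟩ : (Polynomial.X - Polynomial.C r) ∣ f := by
    rw [Polynomial.dvd_iff_isRoot, Polynomial.IsRoot, heval, hFv, hFu]
    simp
  have hdeg : ∀ {H : MvPolynomial (Fin 3) ℂ}, H.IsHomogeneous 3 → eval P H ≠ 0 →
      ((affinePoly Q N P H).map
      (dualSubst x 1 : Polynomial ℂ →+* DualNumber ℂ)).natDegree = 3 := by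
    intro H hH hHP
    rw [Polynomial.natDegree_map_of_leadingCoeff_ne_zero, (affinePoly_natDegree hH hHP).1]
    rw [(affinePoly_natDegree hH hHP).2]
    intro h
    exact hHP (by simpa [fst_dualSubst] using congrArg TrivSqZeroExt.fst h)
  have hq0 : q ≠ 0 := by
    rintro rfl
    have := hdeg hF hFP
    rw [← hf, hq] at this
    simp at this
  have hqd : q.natDegree = 2 := by
    have := hdeg hF hFP
    rw [← hf, hq, (Polynomial.monic_X_sub_C r).natDegree_mul' hq0, Polynomial.natDegree_X_sub_C]
      at this
    omega
  have hmul := Polynomial.resultant_mul_left (Polynomial.X - Polynomial.C r) q g 3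
    (hdeg hG hGP).le
  rw [← hq, Polynomial.natDegree_X_sub_C, hqd, Polynomial.resultant_X_sub_C_left _ _ _
    (hdeg hG hGP).le, heval, hGv, hres] at hmul
  have hf0 : f.map dualFst = linePoly (x • Q + N) P F := by
    rw [hf, Polynomial.map_map, dualFst_comp_dualSubst, affinePoly_map_eval]
  have hg0 : g.map dualFst = linePoly (x • Q + N) P G := by
    rw [hg, Polynomial.map_map, dualFst_comp_dualSubst, affinePoly_map_eval]
  have hqf : linePoly (x • Q + N) P F = (Polynomial.X - Polynomial.C z) * q.map dualFst := by
    rw [← hf0, hq, Polynomial.map_mul]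
    simp [hr, dualFst_apply]
  have hq0' : q.map dualFst ≠ 0 := by
    intro h
    exact linePoly_ne_zero hF hFP (x • Q + N) (by rw [hqf, h, mul_zero])
  have hqd' : (q.map dualFst).natDegree = 2 := by
    have := natDegree_linePoly hF (x • Q + N) (P := P) (by rwa [aeval_eq_eval])
    rw [hqf, (Polynomial.monic_X_sub_C z).natDegree_mul' hq0', Polynomial.natDegree_X_sub_C]
      at this
    omega
  have hunit : dualFst (Polynomial.resultant q g 2 3) ≠ 0 := by
    rw [← Polynomial.resultant_map_map, hg0]
    have h := resultant_eq_zero_iff_exists_root (q := linePoly (x • Q + N) P G) hq0'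
    rw [hqd', natDegree_linePoly hG _ (by rwa [aeval_eq_eval])] at h
    rw [ne_eq, h]
    rintro ⟨z', hz1, hz2⟩
    have hz3 : (linePoly (x • Q + N) P F).eval z' = 0 := by
      rw [hqf, Polynomial.eval_mul, hz1, mul_zero]
    rw [eval_linePoly_complex] at hz2 hz3
    obtain rfl := huniq z' hz3 hz2
    rw [grad_dotProduct_eq_eval_derivative, hqf] at htan
    simp [hz1] at htan
  have := congrArg TrivSqZeroExt.snd hmul
  rw [TrivSqZeroExt.inl_zero, zero_add] at this
  simp only [TrivSqZeroExt.snd_mul, TrivSqZeroExt.fst_inr, TrivSqZeroExt.snd_inr,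
    TrivSqZeroExt.snd_zero, zero_smul, zero_add, MulOpposite.smul_eq_mul_unop,
    MulOpposite.unop_op] at this
  exact mul_ne_zero hGu hunit this.symm

/-! ### The degree of the resultant -/

lemma eval_smul_of_isHomogeneous {F : MvPolynomial (Fin 3) ℂ} {n : ℕ} (hF : F.IsHomogeneous n)
    (c : ℂ) (v : Fin 3 → ℂ) : eval (c • v) F = c ^ n * eval v F := by
  rw [eval_eq', eval_eq', Finset.mul_sum]
  refine Finset.sum_congr rfl fun d hd => ?_
  have hd' : ∑ i, d i = n := by
    rw [← hF (mem_support_iff.1 hd), Finsupp.weight_apply, Finsupp.sum_fintype _ _ (by simp)]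
    simp
  simp only [Pi.smul_apply, smul_eq_mul, mul_pow, Finset.prod_mul_distrib]
  rw [Finset.prod_pow_eq_pow_sum, hd']
  ring

lemma linePoly_eq_scaleRoots (hF : F.IsHomogeneous 3) (hFP : eval P F ≠ 0) {x : ℂ} (hx : x ≠ 0) :
    linePoly (x • Q + N) P F = (linePoly (x⁻¹ • N + Q) P F).scaleRoots x := by
  refine Polynomial.funext fun z => ?_
  have h := Polynomial.scaleRoots_eval_mul (p := linePoly (x⁻¹ • N + Q) P F) (z / x) x
  rw [mul_div_cancel₀ _ hx] at h
  rw [h, natDegree_linePoly hF _ (by rwa [aeval_eq_eval]), eval_linePoly_complex,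
    eval_linePoly_complex, ← eval_smul_of_isHomogeneous hF]
  congr 2
  ext i
  simp
  field_simp
  ring

lemma eval_cubicResultant_eq (hF : F.IsHomogeneous 3) (hG : G.IsHomogeneous 3)
    (hFP : eval P F ≠ 0) (hGP : eval P G ≠ 0) {x : ℂ} (hx : x ≠ 0) :
    (cubicResultant Q N P F G).eval x = x ^ 9 * (cubicResultant N Q P F G).eval x⁻¹ := by
  have h := Polynomial.resultant_scaleRoots (linePoly (x⁻¹ • N + Q) P F)
    (linePoly (x⁻¹ • N + Q) P G) x
  rw [← linePoly_eq_scaleRoots hF hFP hx, ← linePoly_eq_scaleRoots hG hGP hx,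
    natDegree_linePoly hF _ (by rwa [aeval_eq_eval]),
    natDegree_linePoly hG _ (by rwa [aeval_eq_eval]),
    natDegree_linePoly hF _ (by rwa [aeval_eq_eval]),
    natDegree_linePoly hG _ (by rwa [aeval_eq_eval])] at h
  rw [eval_cubicResultant, eval_cubicResultant, h]

lemma natDegree_eq_of_eval_eq_pow_mul {p q : Polynomial ℂ} {n : ℕ}
    (h : ∀ x ≠ 0, p.eval x = x ^ n * q.eval x⁻¹) (hq : q.eval 0 ≠ 0) : p.natDegree = n := by
  have hq0 : q ≠ 0 := by
    rintro rfl
    simp at hq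
  have hrev : Polynomial.X ^ q.natDegree * p = Polynomial.X ^ n * q.reverse := by
    refine Polynomial.eq_of_infinite_eval_eq _ _
      (Set.Infinite.mono (s := {0}ᶜ) (fun x hx => ?_) (Set.finite_singleton 0).infinite_compl)
    have hx : x ≠ 0 := hx
    let := invertibleOfNonzero (inv_ne_zero hx)
    have h1 := Polynomial.eval₂_reverse_mul_pow (RingHom.id ℂ) x⁻¹ q
    simp only [invOf_eq_inv, inv_inv, Polynomial.eval₂_id] at h1
    simp only [Set.mem_ofPred_eq, Polynomial.eval_mul, Polynomial.eval_pow, Polynomial.eval_X]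
    rw [h x hx, ← h1, inv_pow]
    field_simp
  have hqr : q.reverse.natDegree = q.natDegree := by
    rw [Polynomial.reverse_natDegree, Polynomial.natTrailingDegree_eq_zero.2, Nat.sub_zero]
    exact Or.inr (by rwa [Polynomial.coeff_zero_eq_eval_zero])
  have hr0 : q.reverse ≠ 0 := by simpa
  have hp0 : p ≠ 0 := by
    rintro rfl
    rw [mul_zero, eq_comm] at hrev
    exact mul_ne_zero (pow_ne_zero _ Polynomial.X_ne_zero) hr0 hrev
  have := congrArg Polynomial.natDegree hrev
  rw [Polynomial.natDegree_mul (pow_ne_zero _ Polynomial.X_ne_zero) hp0,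
    Polynomial.natDegree_mul (pow_ne_zero _ Polynomial.X_ne_zero) hr0,
    Polynomial.natDegree_X_pow, Polynomial.natDegree_X_pow, hqr] at this
  omega

lemma cubicResultant_natDegree (hF : F.IsHomogeneous 3) (hG : G.IsHomogeneous 3)
    (hFP : eval P F ≠ 0) (hGP : eval P G ≠ 0)
    (hQP : ∀ z : ℂ, eval (Q + z • P) F = 0 → eval (Q + z • P) G ≠ 0) :
    (cubicResultant Q N P F G).natDegree = 9 := by
  refine natDegree_eq_of_eval_eq_pow_mul
    (fun x hx => eval_cubicResultant_eq hF hG hFP hGP hx) fun h => ?_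
  obtain ⟨z, h1, h2⟩ := (cubicResultant_isRoot_iff hF hG hFP hGP 0).1 h
  rw [zero_smul, zero_add] at h1 h2
  exact hQP z h1 h2

/-! ### Finiteness of the intersection and the choice of coordinates -/

lemma eval_smul_eq_zero_iff {n : ℕ} (hF : F.IsHomogeneous n) {c : ℂ} (hc : c ≠ 0)
    (v : Fin 3 → ℂ) : eval (c • v) F = 0 ↔ eval v F = 0 := by
  rw [eval_smul_of_isHomogeneous hF, mul_eq_zero, or_iff_right (pow_ne_zero _ hc)]

lemma finite_setOf_eval_line_eq_zero {n : ℕ} (hF : F.IsHomogeneous n) (hFP : eval P F ≠ 0)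
    (w : Fin 3 → ℂ) : {z : ℂ | eval (w + z • P) F = 0}.Finite := by
  refine (Polynomial.finite_setOfPred_isRoot (linePoly_ne_zero hF hFP w)).subset fun z hz => ?_
  rwa [Set.mem_ofPred_eq, Polynomial.IsRoot, eval_linePoly_complex]

lemma ne_zero_of_eval_ne_zero {n : ℕ} (hF : F.IsHomogeneous n) (hn : n ≠ 0)
    (hFP : eval P F ≠ 0) : P ≠ 0 := by
  rintro rfl
  apply hFP
  have := eval_smul_of_isHomogeneous hF 0 0
  simpa [hn] using this

lemma exists_finset_of_common_zeros (hF : F.IsHomogeneous 3) (hG : G.IsHomogeneous 3)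
    (hF0 : F ≠ 0) (hG0 : G ≠ 0)
    (htrans : ∀ v : Fin 3 → ℂ, v ≠ 0 → eval v F = 0 → eval v G = 0 → Transverse F G v) :
    ∃ S : Finset (Fin 3 → ℂ), (∀ p ∈ S, p ≠ 0 ∧ eval p F = 0 ∧ eval p G = 0) ∧
      ∀ v : Fin 3 → ℂ, v ≠ 0 → eval v F = 0 → eval v G = 0 → ∃ p ∈ S, SameProjPt p v := by
  classical
  obtain ⟨P, hP, -⟩ := exists_eval_ne_zero_and_dotProduct_ne_zero (mul_ne_zero hF0 hG0) ∅
  rw [map_mul] at hP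
  have hFP := left_ne_zero_of_mul hP
  have hGP := right_ne_zero_of_mul hP
  have hP0 := ne_zero_of_eval_ne_zero hF three_ne_zero hFP
  obtain ⟨Q, hQ⟩ := exists_cross_ne_zero hP0
  obtain ⟨N, -, hN⟩ := exists_eval_ne_zero_and_dotProduct_ne_zero hF0 {P ⨯₃ Q}
  have hD := hN _ (Finset.mem_singleton_self _) hQ
  let R := cubicResultant Q N P F G
  have hR : R ≠ 0 := cubicResultant_ne_zero hF hG hFP hGP hD htrans
  let T : Set (Fin 3 → ℂ) :=
    (⋃ x ∈ {x | R.IsRoot x}, (fun z : ℂ => x • Q + N + z • P) ''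
      {z | eval (x • Q + N + z • P) F = 0}) ∪
    (fun z : ℂ => Q + z • P) '' {z | eval (Q + z • P) F = 0}
  have hT : T.Finite := ((Polynomial.finite_setOfPred_isRoot hR).biUnion fun x _ =>
    (finite_setOf_eval_line_eq_zero hF hFP _).image _).union
    ((finite_setOf_eval_line_eq_zero hF hFP _).image _)
  refine ⟨hT.toFinset.filter fun p => p ≠ 0 ∧ eval p F = 0 ∧ eval p G = 0,
    fun p hp => (Finset.mem_filter.1 hp).2, fun v hv hFv hGv => ?_⟩
  have main : ∀ c : ℂ, c ≠ 0 → ∀ w ∈ T, v = c • w →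
      ∃ p ∈ hT.toFinset.filter fun p => p ≠ 0 ∧ eval p F = 0 ∧ eval p G = 0, SameProjPt p v := by
    rintro c hc w hw rfl
    refine ⟨w, Finset.mem_filter.2 ⟨hT.mem_toFinset.2 hw, ?_, ?_, ?_⟩, c, hc, rfl⟩
    · exact (smul_ne_zero_iff.1 hv).2
    · exact (eval_smul_eq_zero_iff hF hc w).1 hFv
    · exact (eval_smul_eq_zero_iff hG hc w).1 hGv
  obtain ⟨a, b, c, rfl⟩ := exists_eq_add_of_triple_ne_zero hD v
  by_cases hb : b = 0
  · by_cases ha : a = 0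
    · subst ha hb
      have hc : c ≠ 0 := by
        rintro rfl
        simp at hv
      simp only [zero_smul, zero_add] at hFv
      exact absurd ((eval_smul_eq_zero_iff hF hc P).1 hFv) hFP
    · have he : a • Q + b • N + c • P = a • (Q + (c / a) • P) := by
        rw [hb, zero_smul, add_zero, smul_add, smul_smul, mul_div_cancel₀ _ ha]
      refine main a ha _ (Or.inr ⟨c / a, ?_, rfl⟩) he
      rwa [he, eval_smul_eq_zero_iff hF ha] at hFv
  · have he : a • Q + b • N + c • P = b • ((a / b) • Q + N + (c / b) • P) := by
      rw [smul_add, smul_add, smul_smul, smul_smul, mul_div_cancel₀ _ hb, mul_div_cancel₀ _ hb]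
    rw [he, eval_smul_eq_zero_iff hF hb] at hFv
    rw [he, eval_smul_eq_zero_iff hG hb] at hGv
    refine main b hb _ (Or.inl (Set.mem_biUnion ?_ ⟨c / b, hFv, rfl⟩)) he
    exact (cubicResultant_isRoot_iff hF hG hFP hGP _).2 ⟨_, hFv, hGv⟩

lemma SameProjPt.symm {u v : Fin 3 → ℂ} (h : SameProjPt u v) : SameProjPt v u := by
  obtain ⟨c, hc, rfl⟩ := h
  exact ⟨c⁻¹, inv_ne_zero hc, by rw [smul_smul, inv_mul_cancel₀ hc, one_smul]⟩

lemma SameProjPt.trans {u v w : Fin 3 → ℂ} (h : SameProjPt u v) (h' : SameProjPt v w) :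
    SameProjPt u w := by
  obtain ⟨c, hc, rfl⟩ := h
  obtain ⟨d, hd, rfl⟩ := h'
  exact ⟨d * c, mul_ne_zero hd hc, by rw [smul_smul]⟩

lemma eq_and_eq_of_sameProjPt_affine (hD : (P ⨯₃ Q) ⬝ᵥ N ≠ 0) {x z x' z' : ℂ}
    (h : SameProjPt (x • Q + N + z • P) (x' • Q + N + z' • P)) : x = x' ∧ z = z' := by
  have h1 := h.cross_eq_zero
  have h2 : x' • Q + N + z' • P = (x • Q + N + z • P) + ((x' - x) • Q + (z' - z) • P) := by
    simp only [sub_smul]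
    abel
  rw [h2, map_add, cross_self, zero_add] at h1
  obtain ⟨h3, h4⟩ := eq_zero_of_cross_affine_point_eq_zero hD h1
  exact ⟨(sub_eq_zero.1 h3).symm, (sub_eq_zero.1 h4).symm⟩

lemma grad_smul_dotProduct_ne_zero {n : ℕ} (hF : F.IsHomogeneous n) {c : ℂ} (hc : c ≠ 0)
    {v : Fin 3 → ℂ} (h : grad F v ⬝ᵥ P ≠ 0) : grad F (c • v) ⬝ᵥ P ≠ 0 := by
  have : grad F (c • v) = c ^ (n - 1) • grad F v := by
    ext i
    simp only [grad, Pi.smul_apply]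
    exact eval_smul_of_isHomogeneous hF.pderiv _ _
  rw [this, smul_dotProduct]
  exact smul_ne_zero (pow_ne_zero _ hc) h

/-- Coordinates in which no two common zeros are collinear with `P`, no line through `P` and a
common zero is tangent to `F` there, and the line through `Q` and `P` contains no common zero. -/
lemma exists_generic_coordinates (hF : F.IsHomogeneous 3) (hG : G.IsHomogeneous 3)
    (hF0 : F ≠ 0) (hG0 : G ≠ 0)
    (htrans : ∀ v : Fin 3 → ℂ, v ≠ 0 → eval v F = 0 → eval v G = 0 → Transverse F G v) :
    ∃ Q N P : Fin 3 → ℂ, eval P F ≠ 0 ∧ eval P G ≠ 0 ∧ (P ⨯₃ Q) ⬝ᵥ N ≠ 0 ∧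
      (∀ v : Fin 3 → ℂ, v ≠ 0 → eval v F = 0 → eval v G = 0 →
        grad F v ⬝ᵥ P ≠ 0 ∧ (P ⨯₃ Q) ⬝ᵥ v ≠ 0) ∧
      ∀ u v : Fin 3 → ℂ, u ≠ 0 → eval u F = 0 → eval u G = 0 →
        v ≠ 0 → eval v F = 0 → eval v G = 0 → (u ⨯₃ v) ⬝ᵥ P = 0 → SameProjPt u v := by
  classical
  obtain ⟨S, hS, hcov⟩ := exists_finset_of_common_zeros hF hG hF0 hG0 htrans
  obtain ⟨P, hP, hPT⟩ := exists_eval_ne_zero_and_dotProduct_ne_zero (mul_ne_zero hF0 hG0)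
    (S.image (grad F) ∪ (S ×ˢ S).image fun p => p.1 ⨯₃ p.2)
  rw [map_mul] at hP
  have hFP := left_ne_zero_of_mul hP
  have hGP := right_ne_zero_of_mul hP
  have hP0 := ne_zero_of_eval_ne_zero hF three_ne_zero hFP
  obtain ⟨w, hw⟩ := exists_cross_ne_zero hP0
  obtain ⟨Q, -, hQ⟩ := exists_eval_ne_zero_and_dotProduct_ne_zero hF0
    (insert (w ⨯₃ P) (S.image fun p => p ⨯₃ P))
  have hPQ : P ⨯₃ Q ≠ 0 := by
    intro h
    refine hQ _ (Finset.mem_insert_self _ _) ?_ ?_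
    · rwa [← cross_anticomm, neg_ne_zero]
    · rw [dot_cross_cyclic, h, zero_dotProduct]
  obtain ⟨N, -, hN⟩ := exists_eval_ne_zero_and_dotProduct_ne_zero hF0 {P ⨯₃ Q}
  refine ⟨Q, N, P, hFP, hGP, hN _ (Finset.mem_singleton_self _) hPQ, ?_, ?_⟩
  · intro v hv hFv hGv
    obtain ⟨p, hp, c, hc, rfl⟩ := hcov v hv hFv hGv
    obtain ⟨hp0, hFp, hGp⟩ := hS p hp
    refine ⟨grad_smul_dotProduct_ne_zero hF hc (hPT _ ?_ ?_), ?_⟩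
    · exact Finset.mem_union_left _ (Finset.mem_image_of_mem _ hp)
    · exact (htrans p hp0 hFp hGp).ne_zero 0
    · rw [dotProduct_smul]
      refine smul_ne_zero hc ?_
      rw [← dot_cross_cyclic]
      refine hQ _ (Finset.mem_insert_of_mem (Finset.mem_image_of_mem _ hp)) fun h => ?_
      obtain ⟨d, hd, rfl⟩ := sameProjPt_of_cross_eq_zero hp0 hP0 h
      exact hFP ((eval_smul_eq_zero_iff hF hd p).2 hFp)
  · intro u v hu hFu hGu hv hFv hGv h
    obtain ⟨p, hp, hpu⟩ := hcov u hu hFu hGu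
    obtain ⟨q, hq, hqv⟩ := hcov v hv hFv hGv
    suffices hpq : SameProjPt p q from hpu.symm.trans (hpq.trans hqv)
    refine sameProjPt_of_cross_eq_zero (hS p hp).1 (hS q hq).1 ?_
    by_contra hne
    refine hPT (p ⨯₃ q) (Finset.mem_union_right _
      (Finset.mem_image.2 ⟨(p, q), Finset.mk_mem_product hp hq, rfl⟩)) hne ?_
    obtain ⟨c, hc, rfl⟩ := hpu
    obtain ⟨d, hd, rfl⟩ := hqv
    simpa [hc, hd] using h

/-- Two smooth cubics, neither a scalar multiple of the other, meeting
transversally at every common projective zero, meet in exactly nine points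
of `ℙ²`. -/
theorem transversal_smooth_cubics_meet_in_nine_points
    (F G : MvPolynomial (Fin 3) ℂ) (hF : SmoothCubic F) (hG : SmoothCubic G)
    (htrans : ∀ v : Fin 3 → ℂ, v ≠ 0 → eval v F = 0 → eval v G = 0 →
      Transverse F G v)
    (hne : ¬ ∃ c : ℂ, F = C c * G) :
    ∃ p : Fin 9 → Fin 3 → ℂ, NinePoints F G p := by
  obtain ⟨⟨hF0, hF⟩, -⟩ := hF
  obtain ⟨⟨hG0, hG⟩, -⟩ := hG
  obtain ⟨Q, N, P, hFP, hGP, hD, hgen, hpair⟩ := exists_generic_coordinates hF hG hF0 hG0 htrans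
  set R := cubicResultant Q N P F G with hRdef
  have hR : R ≠ 0 := cubicResultant_ne_zero hF hG hFP hGP hD htrans
  have hroot : ∀ x, R.eval x = 0 ↔ ∃ z : ℂ, eval (x • Q + N + z • P) F = 0 ∧
      eval (x • Q + N + z • P) G = 0 := cubicResultant_isRoot_iff hF hG hFP hGP
  have huniq : ∀ x z z' : ℂ, eval (x • Q + N + z • P) F = 0 → eval (x • Q + N + z • P) G = 0 →
      eval (x • Q + N + z' • P) F = 0 → eval (x • Q + N + z' • P) G = 0 → z' = z := by
    intro x z z' h1 h2 h3 h4
    refine (eq_and_eq_of_sameProjPt_affine hD (hpair _ _ (affine_point_ne_zero hD x z') h3 h4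
      (affine_point_ne_zero hD x z) h1 h2 ?_)).2
    simp [cross_apply, dotProduct, Fin.sum_univ_three]
    ring
  have hdeg : R.natDegree = 9 := by
    refine cubicResultant_natDegree hF hG hFP hGP fun z h1 h2 => ?_
    have hv : Q + z • P ≠ 0 := by
      intro h
      apply hD
      rw [eq_neg_of_add_eq_zero_left h]
      simp
    apply (hgen _ hv h1 h2).2
    simp [dotProduct_comm (P ⨯₃ Q)]
  have hnodup : R.roots.Nodup := by
    rw [Multiset.nodup_iff_count_le_one]
    intro x
    rw [Polynomial.count_roots]
    by_contra! hlt
    have hdvd : (Polynomial.X - Polynomial.C x) ^ 2 ∣ R :=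
      (Polynomial.le_rootMultiplicity_iff hR).1 hlt
    obtain ⟨z, h1, h2⟩ := (hroot x).1
      (Polynomial.dvd_iff_isRoot.1 ((dvd_pow_self _ two_ne_zero).trans hdvd))
    have hv := affine_point_ne_zero hD x z
    exact not_sq_dvd_cubicResultant hF hG hFP hGP hD h1 h2 (htrans _ hv h1 h2)
      (hgen _ hv h1 h2).1 (fun z' => huniq x z z' h1 h2) hdvd
  have hcard : R.roots.toFinset.card = 9 := by
    rw [Multiset.toFinset_card_of_nodup hnodup, ← hdeg]
    exact IsAlgClosed.card_roots_eq_natDegree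
  let e : Fin 9 ≃ R.roots.toFinset := (R.roots.toFinset.equivFinOfCardEq hcard).symm
  have he : ∀ i, ∃ z : ℂ, eval ((e i : ℂ) • Q + N + z • P) F = 0 ∧
      eval ((e i : ℂ) • Q + N + z • P) G = 0 := fun i =>
    (hroot _).1 (Polynomial.isRoot_of_mem_roots (Multiset.mem_toFinset.1 (e i).2))
  choose z hzF hzG using he
  refine ⟨fun i => (e i : ℂ) • Q + N + z i • P, fun i => affine_point_ne_zero hD _ _, ?_,
    fun i => ⟨hzF i, hzG i⟩, ?_⟩
  · intro i j hij h
    exact hij (e.injective (Subtype.ext (eq_and_eq_of_sameProjPt_affine hD h).1))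
  · intro v hv hFv hGv
    have hb := (hgen v hv hFv hGv).2
    obtain ⟨a, b, c, rfl⟩ := exists_eq_add_of_triple_ne_zero hD v
    have hb : b ≠ 0 := by
      rintro rfl
      simp [dotProduct_comm (P ⨯₃ Q)] at hb
    have hs : a • Q + b • N + c • P = b • ((a / b) • Q + N + (c / b) • P) := by
      rw [smul_add, smul_add, smul_smul, smul_smul, mul_div_cancel₀ _ hb, mul_div_cancel₀ _ hb]
    rw [hs, eval_smul_eq_zero_iff hF hb] at hFv
    rw [hs, eval_smul_eq_zero_iff hG hb] at hGv
    obtain ⟨i, hi⟩ := e.surjective ⟨a / b, Multiset.mem_toFinset.2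
      ((Polynomial.mem_roots hR).2 ((hroot _).2 ⟨_, hFv, hGv⟩))⟩
    have hx : (e i : ℂ) = a / b := congrArg Subtype.val hi
    refine ⟨i, b, hb, ?_⟩
    have hzF' := hzF i
    have hzG' := hzG i
    rw [hx] at hzF' hzG'
    simp only [hx]
    rw [hs, huniq _ _ _ hFv hGv hzF' hzG']
end

section
/- Let F and G be bihomogeneous polynomials of bidegree (2,2) in ℂ[x₀,x₁,y₀,y₁] whose common zero set in ℙ¹ × ℙ¹ consists of exactly eight distinct points q₁,…,q₈, with F and G meeting transversally at each of these points. If H is any bihomogeneous polynomial of bidegree (2,2) that vanishes at seven of the eight points, then H also vanishes at the eighth point. -/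
open MvPolynomial

/-- We view `ℂ[x₀,x₁,y₀,y₁]` as `MvPolynomial (Fin 4) ℂ`, with variables
`X 0 = x₀`, `X 1 = x₁`, `X 2 = y₀`, `X 3 = y₁`. Bihomogeneous of bidegree
`(2,2)`: every monomial has degree 2 in `x₀, x₁` and degree 2 in `y₀, y₁`. -/
def IsBihomog22 (F : MvPolynomial (Fin 4) ℂ) : Prop :=
  ∀ d ∈ F.support, d 0 + d 1 = 2 ∧ d 2 + d 3 = 2

/-- The gradient in `ℂ⁴`. -/
noncomputable def grad4 (F : MvPolynomial (Fin 4) ℂ) (w : Fin 4 → ℂ) : Fin 4 → ℂ :=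
  fun i => eval w (pderiv i F)

/-- `w ∈ ℂ⁴` represents a point of `ℙ¹ × ℙ¹`: both halves are nonzero. -/
def IsP1xP1Rep (w : Fin 4 → ℂ) : Prop :=
  (w 0 ≠ 0 ∨ w 1 ≠ 0) ∧ (w 2 ≠ 0 ∨ w 3 ≠ 0)

/-- Two representatives give the same point of `ℙ¹ × ℙ¹`. -/
def SameP1xP1Pt (u w : Fin 4 → ℂ) : Prop :=
  ∃ c d : ℂ, c ≠ 0 ∧ d ≠ 0 ∧
    w 0 = c * u 0 ∧ w 1 = c * u 1 ∧ w 2 = d * u 2 ∧ w 3 = d * u 3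

/-- `F` and `G` meet transversally at the point represented by `w`. -/
def Transverse4 (F G : MvPolynomial (Fin 4) ℂ) (w : Fin 4 → ℂ) : Prop :=
  LinearIndependent ℂ ![grad4 F w, grad4 G w]

/-- The common zero set of `F` and `G` in `ℙ¹ × ℙ¹` consists of exactly the
eight distinct points represented by `q 0, …, q 7`. -/
def EightPoints (F G : MvPolynomial (Fin 4) ℂ) (q : Fin 8 → Fin 4 → ℂ) : Prop :=
  (∀ i, IsP1xP1Rep (q i)) ∧
  (∀ i j, i ≠ j → ¬ SameP1xP1Pt (q i) (q j)) ∧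
  (∀ i, eval (q i) F = 0 ∧ eval (q i) G = 0) ∧
  (∀ w : Fin 4 → ℂ, IsP1xP1Rep w → eval w F = 0 → eval w G = 0 →
    ∃ i, SameP1xP1Pt (q i) w)

/-- The exponent vector of `x₀ⁱ x₁²⁻ⁱ y₀ʲ y₁²⁻ʲ`. -/
noncomputable def bidegExponent (i j : Fin 3) : Fin 4 →₀ ℕ :=
  Finsupp.equivFunOnFinite.symm ![(i : ℕ), 2 - i, (j : ℕ), 2 - j]

/-- The polynomial of bidegree `(2,2)` with a given `3 × 3` matrix of coefficients. -/
noncomputable def bidegPoly : Matrix (Fin 3) (Fin 3) ℂ →ₗ[ℂ] MvPolynomial (Fin 4) ℂ where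
  toFun c := ∑ i, ∑ j, monomial (bidegExponent i j) (c i j)
  map_add' c d := by simp [Finset.sum_add_distrib]
  map_smul' r c := by simp [Finset.smul_sum, smul_monomial]

lemma bidegPoly_apply (c : Matrix (Fin 3) (Fin 3) ℂ) :
    bidegPoly c = ∑ i, ∑ j, monomial (bidegExponent i j) (c i j) := rfl

lemma IsBihomog22.exists_bidegPoly_eq {F : MvPolynomial (Fin 4) ℂ} (hF : IsBihomog22 F) :
    ∃ c, bidegPoly c = F := by
  suffices F ∈ LinearMap.range bidegPoly from this
  rw [F.as_sum]
  refine Submodule.sum_mem _ fun d hd => ?_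
  obtain ⟨h1, h2⟩ := hF d hd
  have hi : d 0 < 3 := by omega
  have hj : d 2 < 3 := by omega
  have hexp : bidegExponent ⟨d 0, hi⟩ ⟨d 2, hj⟩ = d := by
    ext k
    fin_cases k <;> simp [bidegExponent] <;> omega
  refine ⟨Matrix.single ⟨d 0, hi⟩ ⟨d 2, hj⟩ (coeff d F), ?_⟩
  rw [bidegPoly_apply, Finset.sum_eq_single ⟨d 0, hi⟩, Finset.sum_eq_single ⟨d 2, hj⟩]
  · rw [Matrix.single_apply_same, hexp]
  · intro j _ hne
    rw [Matrix.single_apply_of_ne _ _ _ _ _ (by tauto), map_zero]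
  · simp
  · intro i _ hne
    refine Finset.sum_eq_zero fun j _ => ?_
    rw [Matrix.single_apply_of_ne _ _ _ _ _ (by tauto), map_zero]
  · simp

lemma eval_bidegPoly (c : Matrix (Fin 3) (Fin 3) ℂ) (w : Fin 4 → ℂ) :
    eval w (bidegPoly c) =
      w 1 ^ 2 * (c 0 0 * w 3 ^ 2 + c 0 1 * (w 2 * w 3) + c 0 2 * w 2 ^ 2) +
      w 0 * w 1 * (c 1 0 * w 3 ^ 2 + c 1 1 * (w 2 * w 3) + c 1 2 * w 2 ^ 2) +
      w 0 ^ 2 * (c 2 0 * w 3 ^ 2 + c 2 1 * (w 2 * w 3) + c 2 2 * w 2 ^ 2) := by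
  simp [bidegPoly_apply, eval_monomial, Finsupp.prod_fintype, Fin.prod_univ_four,
    Fin.sum_univ_three, bidegExponent]
  ring

/-- Vanishing of a form of bidegree `(2,2)` does not depend on the representative. -/
lemma IsBihomog22.eval_eq_zero_of_samePt {F : MvPolynomial (Fin 4) ℂ} (hF : IsBihomog22 F)
    {u w : Fin 4 → ℂ} (h : SameP1xP1Pt u w) (hw : eval w F = 0) : eval u F = 0 := by
  obtain ⟨c, rfl⟩ := hF.exists_bidegPoly_eq
  obtain ⟨r, s, hr, hs, h0, h1, h2, h3⟩ := h
  rw [eval_bidegPoly] at hw ⊢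
  rw [h0, h1, h2, h3] at hw
  have : (r ^ 2 * s ^ 2) ≠ 0 := by positivity
  refine (mul_eq_zero.mp ?_).resolve_left this
  rw [← hw]
  ring

/-- Nonzero vectors of `ℂ²` with vanishing determinant are proportional. -/
lemma exists_smul_of_det_eq_zero {a b c d : ℂ} (hab : a ≠ 0 ∨ b ≠ 0) (hcd : c ≠ 0 ∨ d ≠ 0)
    (h : a * d = c * b) : ∃ r : ℂ, r ≠ 0 ∧ c = r * a ∧ d = r * b := by
  by_cases ha : a = 0
  · subst ha
    have hb : b ≠ 0 := by tauto
    have hc : c = 0 := by simpa [hb] using h.symm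
    subst hc
    have hd : d ≠ 0 := by tauto
    exact ⟨d / b, div_ne_zero hd hb, by simp, by field_simp⟩
  · have hc : c ≠ 0 := by
      rintro rfl
      have : d = 0 := by simpa [ha] using h
      tauto
    exact ⟨c / a, div_ne_zero hc ha, by field_simp, by field_simp; linear_combination h⟩

lemma sameP1xP1Pt_of_det_eq_zero {u w : Fin 4 → ℂ} (hu : IsP1xP1Rep u) (hw : IsP1xP1Rep w)
    (hx : u 0 * w 1 = w 0 * u 1) (hy : u 2 * w 3 = w 2 * u 3) : SameP1xP1Pt u w := by
  obtain ⟨r, hr, h0, h1⟩ := exists_smul_of_det_eq_zero hu.1 hw.1 hx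
  obtain ⟨s, hs, h2, h3⟩ := exists_smul_of_det_eq_zero hu.2 hw.2 hy
  exact ⟨r, s, hr, hs, h0, h1, h2, h3⟩

lemma SameP1xP1Pt.det_eq_zero {u v w : Fin 4 → ℂ} (hv : SameP1xP1Pt u v)
    (hw : SameP1xP1Pt u w) : v 0 * w 1 = w 0 * v 1 ∧ v 2 * w 3 = w 2 * v 3 := by
  obtain ⟨r, s, -, -, h0, h1, h2, h3⟩ := hv
  obtain ⟨r', s', -, -, h0', h1', h2', h3'⟩ := hw
  rw [h0, h1, h2, h3, h0', h1', h2', h3']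
  constructor <;> ring

/-- A binary form of degree `n` with `n + 1` distinct zeros in `ℙ¹` has zero coefficients. -/
lemma binaryForm_eq_zero {n : ℕ} (a s t : Fin (n + 1) → ℂ)
    (hst : ∀ i j, i ≠ j → s i * t j ≠ s j * t i)
    (hz : ∀ i, ∑ k : Fin (n + 1), a k * (s i ^ (k : ℕ) * t i ^ (k.rev : ℕ)) = 0) : a = 0 := by
  refine Matrix.eq_zero_of_mulVec_eq_zero (M := Matrix.projVandermonde s t) ?_ ?_
  · rw [Matrix.det_projVandermonde]
    refine Finset.prod_ne_zero_iff.mpr fun i _ => Finset.prod_ne_zero_iff.mpr fun j hj => ?_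
    exact sub_ne_zero.mpr (hst j i (Finset.mem_Ioi.mp hj).ne')
  · ext i
    rw [Pi.zero_apply, ← hz i]
    simp [Matrix.mulVec, dotProduct, Matrix.projVandermonde_apply, mul_comm]

/-- A parametrized curve on which `F` and `G` restrict to binary forms of degree `n` contains at
most `n` of the common zeros. -/
lemma EightPoints.false_of_curve {F G : MvPolynomial (Fin 4) ℂ} {q : Fin 8 → Fin 4 → ℂ}
    (hq : EightPoints F G q) {n : ℕ} (γ : ℂ → ℂ → Fin 4 → ℂ) (a b : Fin (n + 1) → ℂ)
    (ha : ∀ s t, eval (γ s t) F = ∑ k : Fin (n + 1), a k * (s ^ (k : ℕ) * t ^ (k.rev : ℕ)))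
    (hb : ∀ s t, eval (γ s t) G = ∑ k : Fin (n + 1), b k * (s ^ (k : ℕ) * t ^ (k.rev : ℕ)))
    (hrep : ∀ s, IsP1xP1Rep (γ s 1))
    (hinj : ∀ s t, γ s 1 0 * γ t 1 1 = γ t 1 0 * γ s 1 1 →
      γ s 1 2 * γ t 1 3 = γ t 1 2 * γ s 1 3 → s = t)
    (s t : Fin (n + 1) → ℂ) (hst : ∀ i j, i ≠ j → s i * t j ≠ s j * t i)
    (hF : ∀ i, eval (γ (s i) (t i)) F = 0) (hG : ∀ i, eval (γ (s i) (t i)) G = 0) : False := by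
  have ha0 : a = 0 := binaryForm_eq_zero a s t hst fun i => by rw [← ha, hF]
  have hb0 : b = 0 := binaryForm_eq_zero b s t hst fun i => by rw [← hb, hG]
  have hex : ∀ r : ℂ, ∃ i, SameP1xP1Pt (q i) (γ r 1) := fun r =>
    hq.2.2.2 _ (hrep r) (by simp [ha, ha0]) (by simp [hb, hb0])
  choose f hf using hex
  obtain ⟨r, r', hne, heq⟩ := Finite.exists_ne_map_eq_of_infinite f
  obtain ⟨h1, h2⟩ := (hf r).det_eq_zero (heq ▸ hf r')
  exact hne (hinj r r' h1 h2)

section EightPoints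

variable {F G : MvPolynomial (Fin 4) ℂ} {q : Fin 8 → Fin 4 → ℂ}

lemma EightPoints.det_ne_zero (hq : EightPoints F G q) {i j : Fin 8} (hij : i ≠ j) :
    q i 0 * q j 1 ≠ q j 0 * q i 1 ∨ q i 2 * q j 3 ≠ q j 2 * q i 3 := by
  by_contra! h
  exact hq.2.1 i j hij (sameP1xP1Pt_of_det_eq_zero (hq.1 i) (hq.1 j) h.1 h.2)

lemma EightPoints.not_three_fst_eq (hF : IsBihomog22 F) (hG : IsBihomog22 G)
    (hq : EightPoints F G q) {u v : ℂ} (huv : u ≠ 0 ∨ v ≠ 0) {a b c : Fin 8} (hab : a ≠ b)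
    (hac : a ≠ c) (hbc : b ≠ c) (ha : q a 0 * v = u * q a 1) (hb : q b 0 * v = u * q b 1)
    (hc : q c 0 * v = u * q c 1) : False := by
  have key : ∀ i, q i 0 * v = u * q i 1 → SameP1xP1Pt ![u, v, q i 2, q i 3] (q i) := fun i hi =>
    sameP1xP1Pt_of_det_eq_zero ⟨huv, (hq.1 i).2⟩ (hq.1 i) hi.symm rfl
  have hpar : ∀ i j, q i 0 * v = u * q i 1 → q j 0 * v = u * q j 1 →
      q i 0 * q j 1 = q j 0 * q i 1 := by
    intro i j hi hj
    rcases huv with h | h <;> refine mul_left_cancel₀ h ?_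
    · linear_combination -q i 0 * hj + q j 0 * hi
    · linear_combination q j 1 * hi - q i 1 * hj
  have hall : ∀ k, q (![a, b, c] k) 0 * v = u * q (![a, b, c] k) 1 := by
    intro k; fin_cases k <;> assumption
  have hne : ∀ i j, i ≠ j → (![a, b, c] i : Fin 8) ≠ ![a, b, c] j := by
    intro i j; fin_cases i <;> fin_cases j <;> simp [*, Ne.symm]
  obtain ⟨f, rfl⟩ := hF.exists_bidegPoly_eq
  obtain ⟨g, rfl⟩ := hG.exists_bidegPoly_eq
  refine hq.false_of_curve (n := 2) (fun s t => ![u, v, s, t])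
    (fun k => v ^ 2 * f 0 k + u * v * f 1 k + u ^ 2 * f 2 k)
    (fun k => v ^ 2 * g 0 k + u * v * g 1 k + u ^ 2 * g 2 k) ?_ ?_ ?_ ?_
    (fun k => q (![a, b, c] k) 2) (fun k => q (![a, b, c] k) 3) ?_ ?_ ?_
  · intro s t; rw [eval_bidegPoly]; simp [Fin.sum_univ_three, Fin.rev]; ring
  · intro s t; rw [eval_bidegPoly]; simp [Fin.sum_univ_three, Fin.rev]; ring
  · exact fun s => ⟨huv, by simp⟩
  · intro s t _ h; simpa using h
  · intro i j hij
    exact (hq.det_ne_zero (hne i j hij)).resolve_left (not_not.mpr (hpar _ _ (hall i) (hall j)))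
  · exact fun k => hF.eval_eq_zero_of_samePt (key _ (hall k)) (hq.2.2.1 _).1
  · exact fun k => hG.eval_eq_zero_of_samePt (key _ (hall k)) (hq.2.2.1 _).2

lemma EightPoints.not_three_snd_eq (hF : IsBihomog22 F) (hG : IsBihomog22 G)
    (hq : EightPoints F G q) {u v : ℂ} (huv : u ≠ 0 ∨ v ≠ 0) {a b c : Fin 8} (hab : a ≠ b)
    (hac : a ≠ c) (hbc : b ≠ c) (ha : q a 2 * v = u * q a 3) (hb : q b 2 * v = u * q b 3)
    (hc : q c 2 * v = u * q c 3) : False := by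
  have key : ∀ i, q i 2 * v = u * q i 3 → SameP1xP1Pt ![q i 0, q i 1, u, v] (q i) := fun i hi =>
    sameP1xP1Pt_of_det_eq_zero ⟨(hq.1 i).1, huv⟩ (hq.1 i) rfl hi.symm
  have hpar : ∀ i j, q i 2 * v = u * q i 3 → q j 2 * v = u * q j 3 →
      q i 2 * q j 3 = q j 2 * q i 3 := by
    intro i j hi hj
    rcases huv with h | h <;> refine mul_left_cancel₀ h ?_
    · linear_combination -q i 2 * hj + q j 2 * hi
    · linear_combination q j 3 * hi - q i 3 * hj
  have hall : ∀ k, q (![a, b, c] k) 2 * v = u * q (![a, b, c] k) 3 := by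
    intro k; fin_cases k <;> assumption
  have hne : ∀ i j, i ≠ j → (![a, b, c] i : Fin 8) ≠ ![a, b, c] j := by
    intro i j; fin_cases i <;> fin_cases j <;> simp [*, Ne.symm]
  obtain ⟨f, rfl⟩ := hF.exists_bidegPoly_eq
  obtain ⟨g, rfl⟩ := hG.exists_bidegPoly_eq
  refine hq.false_of_curve (n := 2) (fun s t => ![s, t, u, v])
    (fun k => v ^ 2 * f k 0 + u * v * f k 1 + u ^ 2 * f k 2)
    (fun k => v ^ 2 * g k 0 + u * v * g k 1 + u ^ 2 * g k 2) ?_ ?_ ?_ ?_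
    (fun k => q (![a, b, c] k) 0) (fun k => q (![a, b, c] k) 1) ?_ ?_ ?_
  · intro s t; rw [eval_bidegPoly]; simp [Fin.sum_univ_three, Fin.rev]; ring
  · intro s t; rw [eval_bidegPoly]; simp [Fin.sum_univ_three, Fin.rev]; ring
  · exact fun s => ⟨by simp, huv⟩
  · intro s t h _; simpa using h
  · intro i j hij
    exact (hq.det_ne_zero (hne i j hij)).resolve_right (not_not.mpr (hpar _ _ (hall i) (hall j)))
  · exact fun k => hF.eval_eq_zero_of_samePt (key _ (hall k)) (hq.2.2.1 _).1
  · exact fun k => hG.eval_eq_zero_of_samePt (key _ (hall k)) (hq.2.2.1 _).2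

/-- The value at `w` of the form of bidegree `(1,1)` with coefficient vector `l`. -/
def bilinEval (l w : Fin 4 → ℂ) : ℂ :=
  l 0 * (w 0 * w 2) + l 1 * (w 0 * w 3) + l 2 * (w 1 * w 2) + l 3 * (w 1 * w 3)

/-- The coefficients of the restriction of a form of bidegree `(2,2)` to the graph of
`(s, t) ↦ (-(l₁s + l₃t), l₀s + l₂t)`. -/
def graphCoeff (f : Matrix (Fin 3) (Fin 3) ℂ) (l : Fin 4 → ℂ) : Fin 5 → ℂ :=
  let A : Fin 3 → ℂ := fun i => f i 0 * l 0 ^ 2 - f i 1 * (l 1 * l 0) + f i 2 * l 1 ^ 2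
  let B : Fin 3 → ℂ := fun i => 2 * f i 0 * l 0 * l 2 - f i 1 * (l 1 * l 2 + l 3 * l 0) +
    2 * f i 2 * l 1 * l 3
  let C : Fin 3 → ℂ := fun i => f i 0 * l 2 ^ 2 - f i 1 * (l 3 * l 2) + f i 2 * l 3 ^ 2
  ![C 0, B 0 + C 1, A 0 + B 1 + C 2, A 1 + B 2, A 2]

lemma eval_bidegPoly_graph (f : Matrix (Fin 3) (Fin 3) ℂ) (l : Fin 4 → ℂ) (s t : ℂ) :
    eval ![s, t, -(l 1 * s + l 3 * t), l 0 * s + l 2 * t] (bidegPoly f) =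
      ∑ k : Fin 5, graphCoeff f l k * (s ^ (k : ℕ) * t ^ (k.rev : ℕ)) := by
  rw [eval_bidegPoly]
  simp [Fin.sum_univ_five, Fin.rev, graphCoeff]
  ring

lemma EightPoints.not_five_graph (hF : IsBihomog22 F) (hG : IsBihomog22 G)
    (hq : EightPoints F G q) {l : Fin 4 → ℂ} (hl : l 0 * l 3 ≠ l 1 * l 2) {p : Fin 5 → Fin 8}
    (hp : Function.Injective p) (h : ∀ k, bilinEval l (q (p k)) = 0) : False := by
  have hgr : ∀ s t : ℂ, s ≠ 0 ∨ t ≠ 0 → -(l 1 * s + l 3 * t) ≠ 0 ∨ l 0 * s + l 2 * t ≠ 0 := by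
    intro s t hst
    by_contra! h0
    have hs : (l 0 * l 3 - l 1 * l 2) * s = 0 := by linear_combination l 3 * h0.2 + l 2 * h0.1
    have ht : (l 0 * l 3 - l 1 * l 2) * t = 0 := by linear_combination -l 1 * h0.2 - l 0 * h0.1
    have := sub_ne_zero.mpr hl
    simp_all
  have key : ∀ k, SameP1xP1Pt ![q (p k) 0, q (p k) 1, -(l 1 * q (p k) 0 + l 3 * q (p k) 1),
      l 0 * q (p k) 0 + l 2 * q (p k) 1] (q (p k)) := by
    intro k
    have hk := hq.1 (p k)
    refine sameP1xP1Pt_of_det_eq_zero ⟨hk.1, hgr _ _ hk.1⟩ hk rfl ?_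
    have := h k
    simp only [bilinEval] at this
    simp
    linear_combination -this
  obtain ⟨f, rfl⟩ := hF.exists_bidegPoly_eq
  obtain ⟨g, rfl⟩ := hG.exists_bidegPoly_eq
  refine hq.false_of_curve (n := 4)
    (fun s t => ![s, t, -(l 1 * s + l 3 * t), l 0 * s + l 2 * t]) (graphCoeff f l)
    (graphCoeff g l) (eval_bidegPoly_graph f l) (eval_bidegPoly_graph g l) ?_ ?_
    (fun k => q (p k) 0) (fun k => q (p k) 1) ?_ ?_ ?_
  · exact fun s => ⟨by simp, hgr _ _ (by simp)⟩
  · intro s t h _; simpa using h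
  · intro i j hij hx
    have hy := (hq.det_ne_zero (hp.ne hij)).resolve_left (not_not.mpr hx)
    obtain ⟨r, -, h0, h1⟩ := exists_smul_of_det_eq_zero (hq.1 (p i)).1 (hq.1 (p j)).1 hx
    have hi := h i
    have hj := h j
    simp only [bilinEval] at hi hj
    rw [h0, h1] at hj
    have hr : r ≠ 0 := by
      rintro rfl
      have := (hq.1 (p j)).1
      simp_all
    have hj' : l 0 * (q (p i) 0 * q (p j) 2) + l 1 * (q (p i) 0 * q (p j) 3) +
        l 2 * (q (p i) 1 * q (p j) 2) + l 3 * (q (p i) 1 * q (p j) 3) = 0 := by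
      refine mul_left_cancel₀ hr ?_
      linear_combination hj
    apply hy
    rcases hgr _ _ (hq.1 (p i)).1 with h0 | h0 <;> refine mul_left_cancel₀ h0 ?_
    · linear_combination -q (p i) 2 * hj' + q (p j) 2 * hi
    · linear_combination q (p j) 3 * hi - q (p i) 3 * hj'
  · exact fun k => hF.eval_eq_zero_of_samePt (key k) (hq.2.2.1 _).1
  · exact fun k => hG.eval_eq_zero_of_samePt (key k) (hq.2.2.1 _).2

/-- A degenerate form of bidegree `(1,1)` is a product of two linear forms. -/
lemma exists_bilinEval_eq_mul {l : Fin 4 → ℂ} (hl0 : l ≠ 0) (hl : l 0 * l 3 = l 1 * l 2) :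
    ∃ a b c d : ℂ, (a ≠ 0 ∨ b ≠ 0) ∧ (c ≠ 0 ∨ d ≠ 0) ∧
      ∀ w, bilinEval l w = (w 0 * b - a * w 1) * (w 2 * d - c * w 3) := by
  by_cases h0 : l 0 = 0
  · by_cases h1 : l 1 = 0
    · refine ⟨-1, 0, -l 3, l 2, by simp, ?_, fun w => by simp [bilinEval, h0, h1]; ring⟩
      by_contra! h
      apply hl0
      ext k
      fin_cases k <;> simp_all
    · have h2 : l 2 = 0 := by simpa [h0, h1] using hl.symm
      exact ⟨-l 3, l 1, -1, 0, .inr h1, by simp, fun w => by simp [bilinEval, h0, h2]; ring⟩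
  · refine ⟨-l 2 / l 0, 1, -l 1, l 0, by simp, .inr h0, fun w => ?_⟩
    have h3 : l 3 = l 1 * l 2 / l 0 := by field_simp; linear_combination hl
    simp only [bilinEval, h3]
    field_simp
    ring

lemma EightPoints.bilin_eq_zero_of_five (hF : IsBihomog22 F) (hG : IsBihomog22 G)
    (hq : EightPoints F G q) {l : Fin 4 → ℂ} {p : Fin 5 → Fin 8}
    (hp : Function.Injective p) (h : ∀ k, bilinEval l (q (p k)) = 0) : l = 0 := by
  by_contra hl0
  by_cases hl : l 0 * l 3 = l 1 * l 2
  · obtain ⟨a, b, c, d, hab, hcd, hfac⟩ := exists_bilinEval_eq_mul hl0 hl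
    classical
    let S : Finset (Fin 5) := {k | q (p k) 0 * b = a * q (p k) 1}
    let T : Finset (Fin 5) := {k | q (p k) 2 * d = c * q (p k) 3}
    have hST : S ∪ T = Finset.univ := by
      ext k
      have := h k
      rw [hfac, mul_eq_zero, sub_eq_zero, sub_eq_zero] at this
      simpa [S, T] using this
    have hcard := Finset.card_union_le S T
    rw [hST, Finset.card_univ, Fintype.card_fin] at hcard
    rcases (by omega : 2 < S.card ∨ 2 < T.card) with h2 | h2 <;>
      obtain ⟨x, hx, y, hy, z, hz, hxy, hxz, hyz⟩ := Finset.two_lt_card.mp h2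
    · exact hq.not_three_fst_eq hF hG hab (hp.ne hxy) (hp.ne hxz) (hp.ne hyz)
        (Finset.mem_filter.mp hx).2 (Finset.mem_filter.mp hy).2 (Finset.mem_filter.mp hz).2
    · exact hq.not_three_snd_eq hF hG hcd (hp.ne hxy) (hp.ne hxz) (hp.ne hyz)
        (Finset.mem_filter.mp hx).2 (Finset.mem_filter.mp hy).2 (Finset.mem_filter.mp hz).2
  · exact hq.not_five_graph hF hG hl hp h

/-- The coefficient vector of `(x₀u₁ - u₀x₁)(y₀v₃ - v₂y₁)`. -/
def linesCoeff (u v : Fin 4 → ℂ) : Fin 4 → ℂ :=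
  ![u 1 * v 3, -(u 1 * v 2), -(u 0 * v 3), u 0 * v 2]

lemma bilinEval_linesCoeff (u v w : Fin 4 → ℂ) :
    bilinEval (linesCoeff u v) w = (w 0 * u 1 - u 0 * w 1) * (w 2 * v 3 - v 2 * w 3) := by
  simp [bilinEval, linesCoeff]
  ring

/-- No three of the eight points are collinear in the Segre embedding. -/
lemma EightPoints.exists_bilin_separating (hF : IsBihomog22 F) (hG : IsBihomog22 G)
    (hq : EightPoints F G q) {i a b : Fin 8} (hia : i ≠ a) (hib : i ≠ b) (hab : a ≠ b) :
    ∃ l, bilinEval l (q a) = 0 ∧ bilinEval l (q b) = 0 ∧ bilinEval l (q i) ≠ 0 := by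
  by_contra! h
  have h1 := h (linesCoeff (q a) (q b)) (by rw [bilinEval_linesCoeff]; ring)
    (by rw [bilinEval_linesCoeff]; ring)
  have h2 := h (linesCoeff (q b) (q a)) (by rw [bilinEval_linesCoeff]; ring)
    (by rw [bilinEval_linesCoeff]; ring)
  rw [bilinEval_linesCoeff, mul_eq_zero, sub_eq_zero, sub_eq_zero] at h1 h2
  have ha := hq.det_ne_zero hia
  have hb := hq.det_ne_zero hib
  rcases h1 with h1 | h1 <;> rcases h2 with h2 | h2
  · exact hq.not_three_fst_eq hF hG (hq.1 i).1 hia hib hab rfl h1.symm h2.symm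
  · tauto
  · tauto
  · exact hq.not_three_snd_eq hF hG (hq.1 i).2 hia hib hab rfl h2.symm h1.symm

lemma exists_bilin_ne_zero_through_three (u v w : Fin 4 → ℂ) :
    ∃ l, l ≠ 0 ∧ bilinEval l u = 0 ∧ bilinEval l v = 0 ∧ bilinEval l w = 0 := by
  let M : Matrix (Fin 3) (Fin 4) ℂ := Matrix.of fun k =>
    let z := ![u, v, w] k
    ![z 0 * z 2, z 0 * z 3, z 1 * z 2, z 1 * z 3]
  obtain ⟨l, hl, hl0⟩ := (Submodule.ne_bot_iff _).mp
    (LinearMap.ker_ne_bot_of_finrank_lt (f := M.mulVecLin) (by simp))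
  have hl : ∀ k, M.mulVec l k = 0 := fun k => congrFun hl k
  refine ⟨l, hl0, ?_, ?_, ?_⟩
  · rw [← hl 0]; simp [M, Matrix.mulVec, dotProduct, Fin.sum_univ_four, bilinEval]; ring
  · rw [← hl 1]; simp [M, Matrix.mulVec, dotProduct, Fin.sum_univ_four, bilinEval]; ring
  · rw [← hl 2]; simp [M, Matrix.mulVec, dotProduct, Fin.sum_univ_four, bilinEval]; ring

lemma bilinEval_sub_smul (l m w : Fin 4 → ℂ) (r : ℂ) :
    bilinEval (l - r • m) w = bilinEval l w - r * bilinEval m w := by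
  simp [bilinEval]
  ring

/-- In the Segre embedding, at most one of the planes `abc` and `abd` contains a fifth point `i`. -/
lemma EightPoints.exists_bilin_through_three (hF : IsBihomog22 F) (hG : IsBihomog22 G)
    (hq : EightPoints F G q) {i a b c d : Fin 8} (hinj : Function.Injective ![i, a, b, c, d]) :
    (∃ l, bilinEval l (q a) = 0 ∧ bilinEval l (q b) = 0 ∧ bilinEval l (q c) = 0 ∧
      bilinEval l (q i) ≠ 0) ∨
    (∃ l, bilinEval l (q a) = 0 ∧ bilinEval l (q b) = 0 ∧ bilinEval l (q d) = 0 ∧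
      bilinEval l (q i) ≠ 0) := by
  obtain ⟨l, hl0, hli, hla, hlb⟩ := exists_bilin_ne_zero_through_three (q i) (q a) (q b)
  have hia : i ≠ a := hinj.ne (show (0 : Fin 5) ≠ 1 by decide)
  have hib : i ≠ b := hinj.ne (show (0 : Fin 5) ≠ 2 by decide)
  have hab : a ≠ b := hinj.ne (show (1 : Fin 5) ≠ 2 by decide)
  obtain ⟨m, hma, hmb, hmi⟩ := hq.exists_bilin_separating hF hG hia hib hab
  have key : ∀ e, bilinEval l (q e) ≠ 0 →
      ∃ l, bilinEval l (q a) = 0 ∧ bilinEval l (q b) = 0 ∧ bilinEval l (q e) = 0 ∧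
        bilinEval l (q i) ≠ 0 := by
    intro e he
    refine ⟨m - (bilinEval m (q e) / bilinEval l (q e)) • l, ?_, ?_, ?_, ?_⟩ <;>
      rw [bilinEval_sub_smul]
    · rw [hma, hla]; ring
    · rw [hmb, hlb]; ring
    · field_simp; ring
    · rw [hli, mul_zero, sub_zero]; exact hmi
  by_contra h
  rw [not_or] at h
  refine hl0 (hq.bilin_eq_zero_of_five hF hG hinj fun k => ?_)
  fin_cases k
  · exact hli
  · exact hla
  · exact hlb
  · exact not_not.mp (mt (key c) h.1)
  · exact not_not.mp (mt (key d) h.2)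

/-- Coefficients of the product of two forms of bidegree `(1,1)`. -/
def mulCoeff (l m : Fin 4 → ℂ) : Matrix (Fin 3) (Fin 3) ℂ :=
  !![l 3 * m 3, l 2 * m 3 + l 3 * m 2, l 2 * m 2;
    l 1 * m 3 + l 3 * m 1, l 0 * m 3 + l 3 * m 0 + l 1 * m 2 + l 2 * m 1, l 0 * m 2 + l 2 * m 0;
    l 1 * m 1, l 0 * m 1 + l 1 * m 0, l 0 * m 0]

lemma eval_bidegPoly_mulCoeff (l m w : Fin 4 → ℂ) :
    eval w (bidegPoly (mulCoeff l m)) = bilinEval l w * bilinEval m w := by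
  rw [eval_bidegPoly]
  simp [mulCoeff, bilinEval]
  ring

/-- Any six of the points can be separated from a seventh by a form of bidegree `(2,2)`. -/
lemma EightPoints.exists_bidegPoly_separating (hF : IsBihomog22 F) (hG : IsBihomog22 G)
    (hq : EightPoints F G q) {i : Fin 8} {a : Fin 6 → Fin 8} (ha : Function.Injective a)
    (hi : ∀ k, a k ≠ i) :
    ∃ c, (∀ k, eval (q (a k)) (bidegPoly c) = 0) ∧ eval (q i) (bidegPoly c) ≠ 0 := by
  let good (x y z : Fin 6) : Prop := ∃ l, bilinEval l (q (a x)) = 0 ∧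
    bilinEval l (q (a y)) = 0 ∧ bilinEval l (q (a z)) = 0 ∧ bilinEval l (q i) ≠ 0
  have hgood : ∀ x y z w : Fin 6, Function.Injective ![x, y, z, w] →
      good x y z ∨ good x y w := by
    intro x y z w hinj
    refine hq.exists_bilin_through_three hF hG ?_
    have : ![i, a x, a y, a z, a w] = Fin.cons i (a ∘ ![x, y, z, w]) := by
      ext k; fin_cases k <;> rfl
    rw [this, Fin.cons_injective_iff]
    refine ⟨?_, ha.comp hinj⟩
    rintro ⟨k, hk⟩
    exact hi _ hk
  have h1 := hgood 0 1 2 3 (by decide)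
  have h2 := hgood 0 1 2 4 (by decide)
  have h3 := hgood 0 1 3 4 (by decide)
  have hsymm : ∀ x y z, good x y z → good z y x := by
    rintro x y z ⟨l, h1, h2, h3, h4⟩
    exact ⟨l, h3, h2, h1, h4⟩
  have h4 := (hgood 4 5 3 2 (by decide)).imp (hsymm _ _ _) (hsymm _ _ _)
  have h5 := (hgood 3 5 4 2 (by decide)).imp_right (hsymm _ _ _)
  have h6 := hgood 2 5 4 3 (by decide)
  have hex : (good 0 1 2 ∧ good 3 5 4) ∨ (good 0 1 3 ∧ good 2 5 4) ∨
      (good 0 1 4 ∧ good 2 5 3) := by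
    clear_value good
    grind
  have hmul : ∀ l m, (∀ k, bilinEval l (q (a k)) = 0 ∨ bilinEval m (q (a k)) = 0) →
      bilinEval l (q i) ≠ 0 → bilinEval m (q i) ≠ 0 →
      ∃ c, (∀ k, eval (q (a k)) (bidegPoly c) = 0) ∧ eval (q i) (bidegPoly c) ≠ 0 :=
    fun l m h hl hm => ⟨mulCoeff l m,
      fun k => by rw [eval_bidegPoly_mulCoeff]; exact mul_eq_zero.mpr (h k),
      by rw [eval_bidegPoly_mulCoeff]; exact mul_ne_zero hl hm⟩
  rcases hex with ⟨⟨l, hl0, hl1, hl2, hl⟩, m, hm0, hm1, hm2, hm⟩ |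
    ⟨⟨l, hl0, hl1, hl2, hl⟩, m, hm0, hm1, hm2, hm⟩ |
    ⟨⟨l, hl0, hl1, hl2, hl⟩, m, hm0, hm1, hm2, hm⟩ <;>
  refine hmul l m (fun k => ?_) hl hm <;> fin_cases k
  exacts [.inl hl0, .inl hl1, .inl hl2, .inr hm0, .inr hm2, .inr hm1,
    .inl hl0, .inl hl1, .inr hm0, .inl hl2, .inr hm2, .inr hm1,
    .inl hl0, .inl hl1, .inr hm0, .inr hm2, .inl hl2, .inr hm1]

end EightPoints

lemma Transverse4.linearIndependent {f g : Matrix (Fin 3) (Fin 3) ℂ} {w : Fin 4 → ℂ}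
    (h : Transverse4 (bidegPoly f) (bidegPoly g) w) : LinearIndependent ℂ ![f, g] := by
  rw [Transverse4, LinearIndependent.pair_iff] at h
  rw [LinearIndependent.pair_iff]
  intro s t hst
  refine h s t ?_
  have hpoly : s • bidegPoly f + t • bidegPoly g = 0 := by
    rw [← map_smul, ← map_smul, ← map_add, hst, map_zero]
  ext k
  simpa [grad4, smul_eval] using congrArg (fun P => eval w (pderiv k P)) hpoly

/-- A bidegree-(2,2) curve through seven of the eight transversal intersection
points of two bidegree-(2,2) curves in `ℙ¹ × ℙ¹` passes through the eighth. -/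
theorem bidegree22_through_seven_points_passes_through_eighth
    (F G : MvPolynomial (Fin 4) ℂ) (hF : IsBihomog22 F) (hG : IsBihomog22 G)
    (q : Fin 8 → Fin 4 → ℂ) (hq : EightPoints F G q)
    (htrans : ∀ i, Transverse4 F G (q i))
    (H : MvPolynomial (Fin 4) ℂ) (hH : IsBihomog22 H)
    (j : Fin 8) (hvan : ∀ i, i ≠ j → eval (q i) H = 0) :
    eval (q j) H = 0 := by
  have hsep : ∀ i : {i // i ≠ j}, ∃ c, (∀ k : {i // i ≠ j}, k ≠ i →
      eval (q k) (bidegPoly c) = 0) ∧ eval (q i) (bidegPoly c) = 1 := by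
    rintro ⟨i, hij⟩
    let S : Finset (Fin 8) := {i, j}ᶜ
    have hS : S.card = 6 := by
      rw [Finset.card_compl, Finset.card_pair hij, Fintype.card_fin]
    obtain ⟨c, hc, hci⟩ := hq.exists_bidegPoly_separating hF hG (i := i)
      (S.orderEmbOfFin hS).injective fun k hk => by
        have := S.orderEmbOfFin_mem hS k
        rw [hk] at this
        simp [S] at this
    refine ⟨(eval (q i) (bidegPoly c))⁻¹ • c, ?_, ?_⟩
    · rintro ⟨k, hkj⟩ hki
      have hk : k ∈ S := by
        simp only [ne_eq, Subtype.mk.injEq] at hki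
        simp [S, hki, hkj]
      rw [← Finset.mem_coe, ← S.range_orderEmbOfFin hS] at hk
      obtain ⟨x, rfl⟩ := hk
      rw [map_smul, smul_eval, hc, mul_zero]
    · rw [map_smul, smul_eval, inv_mul_cancel₀ hci]
  choose P hP0 hP1 using hsep
  obtain ⟨f, rfl⟩ := hF.exists_bidegPoly_eq
  obtain ⟨g, rfl⟩ := hG.exists_bidegPoly_eq
  obtain ⟨h, rfl⟩ := hH.exists_bidegPoly_eq
  let E : Matrix (Fin 3) (Fin 3) ℂ →ₗ[ℂ] ({i // i ≠ j} → ℂ) :=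
    LinearMap.pi fun i => (aeval (q i)).toLinearMap ∘ₗ bidegPoly
  have hE : ∀ c i, E c i = eval (q i) (bidegPoly c) := fun c i => by
    simp [E]
  have hsurj : Function.Surjective E := by
    intro v
    refine ⟨∑ i, v i • P i, ?_⟩
    ext k
    rw [map_sum, Finset.sum_apply, Finset.sum_eq_single k]
    · simp [hE, hP1]
    · intro i _ hik
      simp [hE, hP0 i k hik.symm]
    · simp
  have hker : Module.finrank ℂ (LinearMap.ker E) = 2 := by
    have h1 := E.finrank_range_add_finrank_ker
    rw [LinearMap.range_eq_top.mpr hsurj, finrank_top, Module.finrank_fintype_fun_eq_card,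
      Module.finrank_matrix] at h1
    simp at h1
    omega
  have hspan : Submodule.span ℂ (Set.range ![f, g]) = LinearMap.ker E := by
    refine Submodule.eq_of_le_of_finrank_le ?_ ?_
    · rw [Submodule.span_le]
      rintro _ ⟨k, rfl⟩
      fin_cases k <;> ext i
      · simpa [hE] using (hq.2.2.1 i).1
      · simpa [hE] using (hq.2.2.1 i).2
    · rw [hker, finrank_span_eq_card (htrans j).linearIndependent, Fintype.card_fin]
  have hmem : h ∈ LinearMap.ker E := by
    ext i
    simpa [hE] using hvan i i.2
  rw [← hspan, Matrix.range_cons_cons_empty, Submodule.mem_span_pair] at hmem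
  obtain ⟨s, t, rfl⟩ := hmem
  simp [smul_eval, (hq.2.2.1 j).1, (hq.2.2.1 j).2]
end
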